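/- arXiv:2307.10099 — 4 statements merged into one kernel-verified Lean document; each statement's English description precedes it below -/
import Mathlib

section
/- Let d ≥ 1 be an integer, 1 ≤ p < ∞, 1 ≤ v < ∞, and γ > 1. Suppose α_{j,b_n} > 0 for every n ∈ ℕ and j ∈ {1,…,b_n}^d. Choose constants as follows: if d < 2v, let C₁ = 2^{d/2−v}/(1−2^{d/2−v}) and C₄ > (1/2)·C₁^{1/v}·2^{1/v}·d^{1/p}; if d = 2v, let C₂ = 2/(d·log 2) and C₅ > (1/2)·C₂^{1/v}·2^{1/v}·d^{1/p}; if d > 2v, let C₃ = 2^{2(d/2−v)}/(2^{d/2−v}−1) and C₆ > (1/2)·C₃^{1/v}·2^{1/v}·d^{1/p}. Define τ_n = C₄·n^{−1/(2v)}·(log n)^{γ/v} if d < 2v, τ_n = C₅·n^{−1/(2v)}·(log n)^{(1+γ)/v} if d = 2v, and τ_n = C₆·n^{−1/d}·(log n)^{γ/v} if d > 2v. Let P₀ be any Borel probability measure on [0,1)^d and Y₁,…,Y_n i.i.d. with law P₀; let α*_n be the vector with entries α_{j,b_n} + N_j. Then the expectation over the sample of the posterior mass E[ Dirichlet(α*_n)({π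 in the simplex : W_v(Histogram(·|π,b_n), P̄_n) ≥ τ_n}) ] tends to 0 as n → ∞. -/
open MeasureTheory Filter
open scoped ENNReal NNReal Classical BigOperators

noncomputable section

/-- ℓ^p distance on ℝ^d. -/
def lpDist (p : ℝ) {d : ℕ} (x y : Fin d → ℝ) : ℝ :=
  (∑ l, |x l - y l| ^ p) ^ (1 / p)

/-- Wasserstein-v distance with respect to the ℓ^p metric, via couplings. -/
def wassersteinLp (p v : ℝ) {d : ℕ} (μ ν : Measure (Fin d → ℝ)) : ℝ :=
  sInf { r : ℝ | ∃ π : Measure ((Fin d → ℝ) × (Fin d → ℝ)),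
      IsProbabilityMeasure π ∧ π.map Prod.fst = μ ∧ π.map Prod.snd = ν ∧
      r = ∫ z, lpDist p z.1 z.2 ^ v ∂π } ^ (1 / v)

/-- The cube [0,1)^d. -/
def cube (d : ℕ) : Set (Fin d → ℝ) := {x | ∀ l, 0 ≤ x l ∧ x l < 1}

/-- The bin A_{i,b} (0-indexed): ∏_l [i_l/b, (i_l+1)/b). -/
def binSet (d b : ℕ) (i : Fin d → Fin b) : Set (Fin d → ℝ) :=
  {x | ∀ l, (i l : ℝ) / b ≤ x l ∧ x l < ((i l : ℝ) + 1) / b}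

/-- Histogram probability measure with weights `w`: density Σ_i b^d w_i 1_{A_{i,b}}. -/
def histMeasure (d b : ℕ) (w : (Fin d → Fin b) → ℝ) : Measure (Fin d → ℝ) :=
  volume.withDensity fun x =>
    ENNReal.ofReal (∑ i, (b : ℝ) ^ d * w i * Set.indicator (binSet d b i) 1 x)

/-- k_n = n^{1/(2v)} if d ≤ 2v, else n^{1/d}. -/
def kSeq (d : ℕ) (v : ℝ) (n : ℕ) : ℝ :=
  if (d : ℝ) ≤ 2 * v then (n : ℝ) ^ ((1 : ℝ) / (2 * v)) else (n : ℝ) ^ ((1 : ℝ) / d)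

/-- K_n = ⌈log₂ k_n⌉. -/
def KSeq (d : ℕ) (v : ℝ) (n : ℕ) : ℕ := ⌈Real.logb 2 (kSeq d v n)⌉₊

/-- b_n = 2^{K_n}. -/
def bSeq (d : ℕ) (v : ℝ) (n : ℕ) : ℕ := 2 ^ KSeq d v n

/-- Bin count N_j. -/
def binCount (d b : ℕ) {n : ℕ} (Y : Fin n → Fin d → ℝ) (j : Fin d → Fin b) : ℕ :=
  (Finset.univ.filter fun t => Y t ∈ binSet d b j).card

/-- Posterior mean weights π̂_j = (α_j + N_j)/(n + Σ_i α_i). -/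
def postWeight (d b : ℕ) {n : ℕ} (α : (Fin d → Fin b) → ℝ) (Y : Fin n → Fin d → ℝ)
    (j : Fin d → Fin b) : ℝ :=
  (α j + binCount d b Y j) / (n + ∑ i, α i)

/-- The posterior mean histogram P̄_n. -/
def postMeanHist (d : ℕ) (v : ℝ) {n : ℕ} (α : (Fin d → Fin (bSeq d v n)) → ℝ)
    (Y : Fin n → Fin d → ℝ) : Measure (Fin d → ℝ) :=
  histMeasure d (bSeq d v n) (postWeight d (bSeq d v n) α Y)

/-- Dirichlet(β) as the law of normalized independent Gammas. -/
def dirichlet {ι : Type*} [Fintype ι] (β : ι → ℝ) : Measure (ι → ℝ) :=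
  (Measure.pi fun i => ProbabilityTheory.gammaMeasure (β i) 1).map
    fun g i => g i / ∑ j, g j

theorem exists_fiber_matching {I J : Type*} [Fintype I] [DecidableEq J] (f : I → J) (r s : I → ℝ)
    (hr : ∀ i, 0 ≤ r i) (hs : ∀ i, 0 ≤ s i) :
    ∃ q : I → I → ℝ, (∀ i j, 0 ≤ q i j) ∧ (∀ i j, f i ≠ f j → q i j = 0) ∧
      (∀ i, ∑ j, q i j ≤ r i) ∧ (∀ j, ∑ i, q i j ≤ s j) ∧
      ∑ i, (r i - ∑ j, q i j) ≤
        ∑ Q ∈ Finset.univ.image f, |∑ i with f i = Q, r i - ∑ i with f i = Q, s i| := by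
  set R : J → ℝ := fun Q => ∑ i with f i = Q, r i with hR
  set S : J → ℝ := fun Q => ∑ i with f i = Q, s i with hS
  have hR0 : ∀ Q, 0 ≤ R Q := fun Q => Finset.sum_nonneg fun i _ => hr i
  have hS0 : ∀ Q, 0 ≤ S Q := fun Q => Finset.sum_nonneg fun i _ => hs i
  have hM0 : ∀ Q, 0 ≤ max (R Q) (S Q) := fun Q => le_max_of_le_left (hR0 Q)
  have row : ∀ i, ∑ j, (if f i = f j then r i * s j / max (R (f i)) (S (f i)) else 0)
      = r i * (S (f i) / max (R (f i)) (S (f i))) := by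
    intro i
    rw [← Finset.sum_filter, ← Finset.sum_div, ← Finset.mul_sum, mul_div_assoc]
    simp only [hS, eq_comm]
  have col : ∀ j, ∑ i, (if f i = f j then r i * s j / max (R (f i)) (S (f i)) else 0)
      = s j * (R (f j) / max (R (f j)) (S (f j))) := by
    intro j
    rw [← Finset.sum_filter]
    have : ∀ i ∈ Finset.univ.filter (fun i => f i = f j),
        r i * s j / max (R (f i)) (S (f i)) = r i * (s j / max (R (f j)) (S (f j))) := by
      intro i hi
      rw [(Finset.mem_filter.1 hi).2, mul_div_assoc]
    rw [Finset.sum_congr rfl this, ← Finset.sum_mul]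
    change R (f j) * _ = _
    ring
  refine ⟨fun i j => if f i = f j then r i * s j / max (R (f i)) (S (f i)) else 0,
    ?_, ?_, ?_, ?_, ?_⟩
  · intro i j
    dsimp only
    split_ifs
    · exact div_nonneg (mul_nonneg (hr i) (hs j)) (hM0 _)
    · exact le_rfl
  · intro i j h
    simp [h]
  · intro i
    rw [row]
    exact mul_le_of_le_one_right (hr i) (div_le_one_of_le₀ (le_max_right _ _) (hM0 _))
  · intro j
    rw [col]
    exact mul_le_of_le_one_right (hs j) (div_le_one_of_le₀ (le_max_left _ _) (hM0 _))
  · simp only [row]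
    rw [← Finset.sum_fiberwise_of_maps_to (t := Finset.univ.image f) (g := f)
      (fun i _ => Finset.mem_image_of_mem f (Finset.mem_univ i))]
    refine Finset.sum_le_sum fun Q _ => ?_
    have : ∀ i ∈ Finset.univ.filter (fun i => f i = Q),
        r i - r i * (S (f i) / max (R (f i)) (S (f i)))
          = r i * (1 - S Q / max (R Q) (S Q)) := by
      intro i hi
      rw [(Finset.mem_filter.1 hi).2]
      ring
    rw [Finset.sum_congr rfl this, ← Finset.sum_mul]
    change R Q * _ ≤ |R Q - S Q|
    rcases le_total (R Q) (S Q) with h | h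
    · rw [max_eq_right h]
      rcases eq_or_ne (S Q) 0 with h0 | h0
      · have : R Q = 0 := le_antisymm (h0 ▸ h) (hR0 Q)
        simp [this]
      · simp [div_self h0]
    · rw [max_eq_left h]
      rcases eq_or_ne (R Q) 0 with h0 | h0
      · simp [h0]
      · rw [mul_sub, mul_div_cancel₀ _ h0, mul_one]
        exact le_abs_self _

theorem sum_fiber_row_eq_sum_fiber_col {I J : Type*} [Fintype I] [DecidableEq J] (g : I → J) (q : I → I → ℝ)
    (hq : ∀ i j, g i ≠ g j → q i j = 0) (Q : J) :
    ∑ i with g i = Q, ∑ j, q i j = ∑ j with g j = Q, ∑ i, q i j := by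
  rw [Finset.sum_comm (s := Finset.univ.filter fun j => g j = Q), Finset.sum_filter]
  refine Finset.sum_congr rfl fun i _ => ?_
  rw [Finset.sum_filter]
  split_ifs with h
  · refine Finset.sum_congr rfl fun j _ => ?_
    split_ifs with h'
    · rfl
    · exact (hq j i fun h'' => h' (h''.trans h)).symm
  · refine Finset.sum_eq_zero fun j _ => ?_
    split_ifs with h'
    · exact hq j i fun h'' => h (h''.symm.trans h')
    · rfl

theorem exists_multiscale_coupling {I J : Type*} [Fintype I] [DecidableEq J] (f : ℕ → I → J) (c : ℕ → ℝ)
    (hc : ∀ m, 0 ≤ c m) (cost : I → I → ℝ) (K : ℕ)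
    (hcost : ∀ m ≤ K, ∀ i j, f m i = f m j → cost i j ≤ c m)
    (hf : ∀ m < K, ∀ i j, f (m + 1) i = f (m + 1) j → f m i = f m j)
    (h0 : ∀ i j, f 0 i = f 0 j) (r s : I → ℝ)
    (hr : ∀ i, 0 ≤ r i) (hs : ∀ i, 0 ≤ s i) (hrs : ∑ i, r i = ∑ i, s i) :
    ∃ q : I → I → ℝ, (∀ i j, 0 ≤ q i j) ∧ (∀ i, ∑ j, q i j = r i) ∧ (∀ j, ∑ i, q i j = s j) ∧
      ∑ i, ∑ j, q i j * cost i j ≤ c K * ∑ i, r i + ∑ m ∈ Finset.range K, c m *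
        ∑ Q ∈ Finset.univ.image (f (m + 1)),
          |∑ i with f (m + 1) i = Q, r i - ∑ i with f (m + 1) i = Q, s i| := by
  induction K generalizing r s with
  | zero =>
    refine ⟨fun i j => r i * s j / ∑ i, r i, fun i j => div_nonneg (mul_nonneg (hr i) (hs j))
      (Finset.sum_nonneg fun i _ => hr i), ?_, ?_, ?_⟩
    · intro i
      rw [← Finset.sum_div, ← Finset.mul_sum, ← hrs]
      rcases eq_or_ne (∑ i, r i) 0 with h | h
      · simp [(Finset.sum_eq_zero_iff_of_nonneg fun i _ => hr i).1 h i (Finset.mem_univ i)]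
      · field_simp
    · intro j
      rw [← Finset.sum_div, ← Finset.sum_mul]
      rcases eq_or_ne (∑ i, r i) 0 with h | h
      · rw [hrs] at h
        simp [(Finset.sum_eq_zero_iff_of_nonneg fun i _ => hs i).1 h j (Finset.mem_univ j)]
      · field_simp
    · simp only [Finset.range_zero, Finset.sum_empty, add_zero]
      have : ∀ i j, r i * s j / (∑ i, r i) * cost i j ≤ c 0 * (r i * s j / (∑ i, r i)) := by
        intro i j
        rw [mul_comm]
        exact mul_le_mul_of_nonneg_right (hcost 0 le_rfl i j (h0 i j))
          (div_nonneg (mul_nonneg (hr i) (hs j)) (Finset.sum_nonneg fun i _ => hr i))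
      refine (Finset.sum_le_sum fun i _ => Finset.sum_le_sum fun j _ => this i j).trans_eq ?_
      simp only [← Finset.mul_sum, ← Finset.sum_div, ← Finset.sum_mul]
      rw [← hrs, mul_self_div_self]
  | succ K ih =>
    obtain ⟨q, hq0, hqf, hrow, hcol, hres⟩ := exists_fiber_matching (f (K + 1)) r s hr hs
    have hcoarse : ∀ m ≤ K + 1, ∀ i j, f m i ≠ f m j → q i j = 0 := by
      intro m hm i j hij
      apply hqf
      intro h
      apply hij
      induction hm using Nat.decreasingInduction with
      | of_succ k hk ih' => exact hf k (by omega) i j (by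
          by_contra h'
          exact h' (ih' h'))
      | self => exact h
    have hdiff : ∀ m ≤ K + 1, ∀ Q, (∑ i with f m i = Q, (r i - ∑ j, q i j)) -
        ∑ i with f m i = Q, (s i - ∑ j, q j i) =
        ∑ i with f m i = Q, r i - ∑ i with f m i = Q, s i := by
      intro m hm Q
      rw [Finset.sum_sub_distrib, Finset.sum_sub_distrib,
        sum_fiber_row_eq_sum_fiber_col (f m) q (hcoarse m hm)]
      ring
    have htot : ∑ i, (r i - ∑ j, q i j) = ∑ i, (s i - ∑ j, q j i) := by
      rw [Finset.sum_sub_distrib, Finset.sum_sub_distrib, hrs, Finset.sum_comm]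
    obtain ⟨q', hq'0, hrow', hcol', hcost'⟩ := ih (fun m hm => hcost m (by omega))
      (fun m hm => hf m (by omega)) (fun i => r i - ∑ j, q i j) (fun i => s i - ∑ j, q j i)
      (fun i => sub_nonneg.2 (hrow i)) (fun i => sub_nonneg.2 (hcol i)) htot
    refine ⟨fun i j => q i j + q' i j, fun i j => add_nonneg (hq0 i j) (hq'0 i j), ?_, ?_, ?_⟩
    · intro i
      rw [Finset.sum_add_distrib, hrow']
      ring
    · intro j
      rw [Finset.sum_add_distrib, hcol']
      ring
    · have h1 : ∑ i, ∑ j, q i j * cost i j ≤ c (K + 1) * ∑ i, r i := by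
        rw [Finset.mul_sum]
        refine Finset.sum_le_sum fun i _ => ?_
        refine le_trans ?_ (mul_le_mul_of_nonneg_left (hrow i) (hc _))
        rw [Finset.mul_sum]
        refine Finset.sum_le_sum fun j _ => ?_
        by_cases h : f (K + 1) i = f (K + 1) j
        · rw [mul_comm]
          exact mul_le_mul_of_nonneg_right (hcost _ le_rfl i j h) (hq0 i j)
        · simp [hqf i j h]
      have h2 : ∑ m ∈ Finset.range K, c m * ∑ Q ∈ Finset.univ.image (f (m + 1)),
          |(∑ i with f (m + 1) i = Q, (r i - ∑ j, q i j)) -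
            ∑ i with f (m + 1) i = Q, (s i - ∑ j, q j i)| =
          ∑ m ∈ Finset.range K, c m * ∑ Q ∈ Finset.univ.image (f (m + 1)),
          |∑ i with f (m + 1) i = Q, r i - ∑ i with f (m + 1) i = Q, s i| := by
        refine Finset.sum_congr rfl fun m hm => ?_
        congr 1
        refine Finset.sum_congr rfl fun Q _ => ?_
        rw [hdiff (m + 1) (by have := Finset.mem_range.1 hm; omega)]
      rw [h2] at hcost'
      have h3 := mul_le_mul_of_nonneg_left hres (hc K)
      rw [Finset.sum_range_succ]
      simp only [add_mul, Finset.sum_add_distrib]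
      linarith

/-- The uniform probability distribution on the bin `A_{i,b}`. -/
def cellMeasure (d b : ℕ) (i : Fin d → Fin b) : Measure (Fin d → ℝ) :=
  ((b : ℝ≥0∞) ^ d) • volume.restrict (binSet d b i)

theorem binSet_eq_pi (d b : ℕ) (i : Fin d → Fin b) :
    binSet d b i = Set.pi Set.univ fun l => Set.Ico ((i l : ℝ) / b) (((i l : ℝ) + 1) / b) := by
  ext x
  simp [binSet]

theorem measurableSet_binSet (d b : ℕ) (i : Fin d → Fin b) : MeasurableSet (binSet d b i) := by
  rw [binSet_eq_pi]
  exact MeasurableSet.univ_pi fun _ => measurableSet_Ico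

theorem isProbabilityMeasure_cellMeasure {d b : ℕ} (hb : 0 < b) (i : Fin d → Fin b) :
    IsProbabilityMeasure (cellMeasure d b i) := by
  constructor
  have hb' : (0 : ℝ) < b := by exact_mod_cast hb
  have h : ∀ l, ((i l : ℝ) + 1) / b - (i l : ℝ) / b = (b : ℝ)⁻¹ := by
    intro l
    field_simp
    ring
  rw [cellMeasure, Measure.smul_apply, Measure.restrict_apply_univ, binSet_eq_pi,
    Real.volume_pi_Ico]
  simp only [h, Finset.prod_const, Finset.card_univ, Fintype.card_fin, smul_eq_mul]
  rw [ENNReal.ofReal_inv_of_pos hb', ENNReal.ofReal_natCast, ← mul_pow,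
    ENNReal.mul_inv_cancel (by exact_mod_cast hb.ne') (ENNReal.natCast_ne_top b), one_pow]

theorem histMeasure_eq_sum {d b : ℕ} (w : (Fin d → Fin b) → ℝ) (hw : ∀ i, 0 ≤ w i) :
    histMeasure d b w = ∑ i, ENNReal.ofReal (w i) • cellMeasure d b i := by
  have h : (fun x => ENNReal.ofReal
        (∑ i, (b : ℝ) ^ d * w i * Set.indicator (binSet d b i) 1 x)) =
      fun x => ∑ i, (binSet d b i).indicator
        (fun _ => ENNReal.ofReal (w i) * (b : ℝ≥0∞) ^ d) x := by
    funext x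
    rw [ENNReal.ofReal_sum_of_nonneg]
    · refine Finset.sum_congr rfl fun i _ => ?_
      by_cases hx : x ∈ binSet d b i
      · simp only [Set.indicator_of_mem hx, Pi.one_apply, mul_one]
        rw [mul_comm, ENNReal.ofReal_mul (hw i), ENNReal.ofReal_pow (Nat.cast_nonneg b),
          ENNReal.ofReal_natCast]
      · simp [Set.indicator_of_notMem hx]
    · intro i _
      exact mul_nonneg (mul_nonneg (by positivity) (hw i))
        (Set.indicator_nonneg (fun _ _ => zero_le_one) _)
  rw [histMeasure, h]
  ext s hs
  rw [withDensity_apply _ hs, lintegral_finsetSum _ fun i _ =>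
    measurable_const.indicator (measurableSet_binSet d b i)]
  simp only [Measure.coe_finsetSum, Finset.sum_apply, Measure.smul_apply, cellMeasure, smul_eq_mul]
  refine Finset.sum_congr rfl fun i _ => ?_
  rw [lintegral_indicator_const (measurableSet_binSet d b i), Measure.restrict_apply hs,
    Measure.restrict_apply (measurableSet_binSet d b i), Set.inter_comm, mul_assoc]

theorem lpDist_nonneg (p : ℝ) {d : ℕ} (x y : Fin d → ℝ) : 0 ≤ lpDist p x y :=
  Real.rpow_nonneg (Finset.sum_nonneg fun _ _ => Real.rpow_nonneg (abs_nonneg _) _) _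

theorem lpDist_le {p : ℝ} (hp : 0 < p) {d : ℕ} {x y : Fin d → ℝ} {δ : ℝ} (hδ : 0 ≤ δ)
    (h : ∀ l, |x l - y l| ≤ δ) : lpDist p x y ≤ (d : ℝ) ^ (1 / p) * δ := by
  have h1 : ∑ l, |x l - y l| ^ p ≤ d * δ ^ p := by
    refine (Finset.sum_le_sum fun l _ =>
      Real.rpow_le_rpow (abs_nonneg _) (h l) hp.le).trans_eq ?_
    simp
  refine (Real.rpow_le_rpow (Finset.sum_nonneg fun _ _ => Real.rpow_nonneg (abs_nonneg _) _) h1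
    (by positivity)).trans_eq ?_
  rw [Real.mul_rpow (Nat.cast_nonneg d) (by positivity), ← Real.rpow_mul hδ,
    mul_one_div_cancel hp.ne', Real.rpow_one]

theorem measurable_lpDist (p : ℝ) {d : ℕ} :
    Measurable fun z : (Fin d → ℝ) × (Fin d → ℝ) => lpDist p z.1 z.2 := by
  unfold lpDist
  fun_prop

theorem ae_cellMeasure_mem (d b : ℕ) (i : Fin d → Fin b) :
    ∀ᵐ x ∂(cellMeasure d b i), x ∈ binSet d b i :=
  Measure.ae_smul_measure (ae_restrict_mem (measurableSet_binSet d b i)) _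

theorem wassersteinLp_histMeasure_le {p v : ℝ} (hv : 0 < v) {d b : ℕ} (hb : 0 < b)
    (w u : (Fin d → Fin b) → ℝ) (hw1 : ∑ i, w i = 1)
    (q cost : (Fin d → Fin b) → (Fin d → Fin b) → ℝ) (hq : ∀ i j, 0 ≤ q i j)
    (hrow : ∀ i, ∑ j, q i j = w i) (hcol : ∀ j, ∑ i, q i j = u j)
    (hcost0 : ∀ i j, 0 ≤ cost i j)
    (hcost : ∀ i j, ∀ x ∈ binSet d b i, ∀ y ∈ binSet d b j, lpDist p x y ^ v ≤ cost i j) :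
    wassersteinLp p v (histMeasure d b w) (histMeasure d b u) ≤
      (∑ i, ∑ j, q i j * cost i j) ^ (1 / v) := by
  have hprob := fun i : Fin d → Fin b => isProbabilityMeasure_cellMeasure hb i
  have hw : ∀ i, 0 ≤ w i := fun i => hrow i ▸ Finset.sum_nonneg fun j _ => hq i j
  have hu : ∀ i, 0 ≤ u i := fun i => hcol i ▸ Finset.sum_nonneg fun j _ => hq j i
  set π : Measure ((Fin d → ℝ) × (Fin d → ℝ)) := ∑ i, ∑ j, ENNReal.ofReal (q i j) •
    (cellMeasure d b i).prod (cellMeasure d b j) with hπ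
  have hfst : π.map Prod.fst = histMeasure d b w := by
    ext s hs
    rw [Measure.map_apply measurable_fst hs, histMeasure_eq_sum w hw, hπ]
    simp only [Measure.coe_finsetSum, Finset.sum_apply, Measure.smul_apply, smul_eq_mul]
    refine Finset.sum_congr rfl fun i _ => ?_
    rw [← hrow, ENNReal.ofReal_sum_of_nonneg fun j _ => hq i j, Finset.sum_mul]
    refine Finset.sum_congr rfl fun j _ => ?_
    rw [← Set.prod_univ, Measure.prod_prod, measure_univ, mul_one]
  have hsnd : π.map Prod.snd = histMeasure d b u := by
    ext s hs
    rw [Measure.map_apply measurable_snd hs, histMeasure_eq_sum u hu, hπ, Finset.sum_comm]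
    simp only [Measure.coe_finsetSum, Finset.sum_apply, Measure.smul_apply, smul_eq_mul]
    refine Finset.sum_congr rfl fun i _ => ?_
    rw [← hcol, ENNReal.ofReal_sum_of_nonneg fun j _ => hq j i, Finset.sum_mul]
    refine Finset.sum_congr rfl fun j _ => ?_
    rw [← Set.univ_prod, Measure.prod_prod, measure_univ, one_mul]
  have hπprob : IsProbabilityMeasure π := by
    constructor
    have : π Set.univ = (π.map Prod.fst) Set.univ := by
      rw [Measure.map_apply measurable_fst MeasurableSet.univ, Set.preimage_univ]
    rw [this, hfst, histMeasure_eq_sum w hw]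
    simp only [Measure.coe_finsetSum, Finset.sum_apply, Measure.smul_apply, smul_eq_mul,
      measure_univ, mul_one]
    rw [← ENNReal.ofReal_sum_of_nonneg fun i _ => hw i, hw1, ENNReal.ofReal_one]
  have hnn : ∀ z : (Fin d → ℝ) × (Fin d → ℝ), 0 ≤ lpDist p z.1 z.2 ^ v :=
    fun z => Real.rpow_nonneg (lpDist_nonneg p _ _) _
  have hint : ∫ z, lpDist p z.1 z.2 ^ v ∂π ≤ ∑ i, ∑ j, q i j * cost i j := by
    rw [integral_eq_lintegral_of_nonneg_ae (ae_of_all _ hnn)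
      ((measurable_lpDist p).pow_const v).aestronglyMeasurable]
    refine ENNReal.toReal_le_of_le_ofReal (Finset.sum_nonneg fun i _ => Finset.sum_nonneg
      fun j _ => mul_nonneg (hq i j) (hcost0 i j)) ?_
    rw [hπ, ENNReal.ofReal_sum_of_nonneg fun i _ => Finset.sum_nonneg
      fun j _ => mul_nonneg (hq i j) (hcost0 i j)]
    simp only [lintegral_finsetSum_measure, lintegral_smul_measure, smul_eq_mul]
    refine Finset.sum_le_sum fun i _ => ?_
    rw [ENNReal.ofReal_sum_of_nonneg fun j _ => mul_nonneg (hq i j) (hcost0 i j)]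
    refine Finset.sum_le_sum fun j _ => ?_
    rw [ENNReal.ofReal_mul (hq i j)]
    gcongr
    have hae : ∀ᵐ z ∂(cellMeasure d b i).prod (cellMeasure d b j),
        ENNReal.ofReal (lpDist p z.1 z.2 ^ v) ≤ ENNReal.ofReal (cost i j) := by
      filter_upwards [Measure.quasiMeasurePreserving_fst.ae (ae_cellMeasure_mem d b i),
        Measure.quasiMeasurePreserving_snd.ae (ae_cellMeasure_mem d b j)] with z h1 h2
      exact ENNReal.ofReal_le_ofReal (hcost i j _ h1 _ h2)
    refine (lintegral_mono_ae hae).trans_eq ?_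
    simp
  unfold wassersteinLp
  refine Real.rpow_le_rpow (Real.sInf_nonneg ?_) (csInf_le_of_le ⟨0, ?_⟩
    ⟨π, hπprob, hfst, hsnd, rfl⟩ hint) (by positivity)
  · rintro r ⟨μ, -, -, -, rfl⟩
    exact integral_nonneg hnn
  · rintro r ⟨μ, -, -, -, rfl⟩
    exact integral_nonneg hnn

/-- The index of the dyadic cell of side `2^{-m}` containing the bin `A_{i,2^K}`. -/
def coarseIndex {d : ℕ} (K m : ℕ) (i : Fin d → Fin (2 ^ K)) : Fin d → ℕ :=
  fun l => (i l : ℕ) / 2 ^ (K - m)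

theorem coarseIndex_zero {d : ℕ} (K : ℕ) (i : Fin d → Fin (2 ^ K)) : coarseIndex K 0 i = 0 := by
  funext l
  exact Nat.div_eq_of_lt (i l).2

theorem coarseIndex_eq_div {d : ℕ} {K m : ℕ} (hm : m < K) (i : Fin d → Fin (2 ^ K)) (l : Fin d) :
    coarseIndex K m i l = coarseIndex K (m + 1) i l / 2 := by
  rw [coarseIndex, coarseIndex, Nat.div_div_eq_div_mul, ← pow_succ]
  congr 2
  omega

theorem card_image_coarseIndex_le (d : ℕ) {K m : ℕ} (hm : m ≤ K) :
    (Finset.univ.image (coarseIndex (d := d) K m)).card ≤ (2 ^ m) ^ d := by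
  have : Finset.univ.image (coarseIndex (d := d) K m) ⊆
      Fintype.piFinset fun _ : Fin d => Finset.range (2 ^ m) := by
    intro Q hQ
    obtain ⟨i, -, rfl⟩ := Finset.mem_image.1 hQ
    rw [Fintype.mem_piFinset]
    intro l
    rw [Finset.mem_range, coarseIndex, Nat.div_lt_iff_lt_mul (by positivity), ← pow_add,
      Nat.add_sub_cancel' hm]
    exact (i l).2
  refine (Finset.card_le_card this).trans_eq ?_
  simp

theorem abs_sub_le_of_coarseIndex_eq {d K m : ℕ} (hm : m ≤ K) {i j : Fin d → Fin (2 ^ K)}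
    (h : coarseIndex K m i = coarseIndex K m j) {x y : Fin d → ℝ}
    (hx : x ∈ binSet d (2 ^ K) i) (hy : y ∈ binSet d (2 ^ K) j) (l : Fin d) :
    |x l - y l| ≤ (1 / 2) ^ m := by
  have key : ∀ (a : ℕ) (k : Fin d → Fin (2 ^ K)) (z : Fin d → ℝ), coarseIndex K m k l = a →
      z ∈ binSet d (2 ^ K) k →
      (a : ℝ) * (1 / 2) ^ m ≤ z l ∧ z l ≤ ((a : ℝ) + 1) * (1 / 2) ^ m := by
    intro a k z ha hz
    obtain ⟨h1, h2⟩ := hz l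
    have hK : (2 : ℝ) ^ K = 2 ^ (K - m) * 2 ^ m := by rw [← pow_add, Nat.sub_add_cancel hm]
    have e1 : a * 2 ^ (K - m) ≤ (k l : ℕ) := by
      rw [← ha]
      exact Nat.div_mul_le_self _ _
    have e2 : (k l : ℕ) + 1 ≤ (a + 1) * 2 ^ (K - m) := by
      rw [← ha]
      exact (Nat.div_lt_iff_lt_mul (by positivity)).1 (Nat.lt_succ_self _)
    have e1' : (a : ℝ) * 2 ^ (K - m) ≤ (k l : ℕ) := by exact_mod_cast e1
    have e2' : ((k l : ℕ) : ℝ) + 1 ≤ (a + 1) * 2 ^ (K - m) := by exact_mod_cast e2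
    push_cast at h1 h2
    rw [one_div, inv_pow]
    constructor
    · refine le_trans ?_ h1
      rw [hK, ← div_eq_mul_inv, div_le_div_iff₀ (by positivity) (by positivity)]
      nlinarith [show (0 : ℝ) < 2 ^ m by positivity]
    · refine h2.le.trans ?_
      rw [hK, ← div_eq_mul_inv, div_le_div_iff₀ (by positivity) (by positivity)]
      nlinarith [show (0 : ℝ) < 2 ^ m by positivity]
  obtain ⟨hx1, hx2⟩ := key _ i x rfl hx
  obtain ⟨hy1, hy2⟩ := key _ j y (congrFun h l).symm hy
  rw [abs_le]
  constructor <;> linarith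

/-- The multiscale bound on the `v`-th power of the Wasserstein distance between the histograms
with weights `w` and `u` on the dyadic grid of side `2^{-K}`. -/
def multiscaleBound (p v : ℝ) (d K : ℕ) (w u : (Fin d → Fin (2 ^ K)) → ℝ) : ℝ :=
  ((d : ℝ) ^ (1 / p) * (1 / 2) ^ K) ^ v + ∑ m ∈ Finset.range K,
    ((d : ℝ) ^ (1 / p) * (1 / 2) ^ m) ^ v *
      ∑ Q ∈ Finset.univ.image (coarseIndex (d := d) K (m + 1)),
        |∑ i with coarseIndex K (m + 1) i = Q, w i - ∑ i with coarseIndex K (m + 1) i = Q, u i|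

theorem multiscaleBound_nonneg (p v : ℝ) (d K : ℕ) (w u : (Fin d → Fin (2 ^ K)) → ℝ) :
    0 ≤ multiscaleBound p v d K w u := by
  unfold multiscaleBound
  exact add_nonneg (by positivity) (Finset.sum_nonneg fun m _ => mul_nonneg (by positivity)
    (Finset.sum_nonneg fun Q _ => abs_nonneg _))

theorem wassersteinLp_le_multiscaleBound {p v : ℝ} (hp : 0 < p) (hv : 0 < v) (d K : ℕ)
    (w u : (Fin d → Fin (2 ^ K)) → ℝ) (hw : ∀ i, 0 ≤ w i) (hu : ∀ i, 0 ≤ u i)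
    (hw1 : ∑ i, w i = 1) (hu1 : ∑ i, u i = 1) :
    wassersteinLp p v (histMeasure d (2 ^ K) w) (histMeasure d (2 ^ K) u) ≤
      multiscaleBound p v d K w u ^ (1 / v) := by
  set c : ℕ → ℝ := fun m => ((d : ℝ) ^ (1 / p) * (1 / 2) ^ m) ^ v with hc
  have hc0 : ∀ m, 0 ≤ c m := fun m => by positivity
  have hrpow : ∀ {m : ℕ} {x y : Fin d → ℝ}, (∀ l, |x l - y l| ≤ (1 / 2) ^ m) →
      lpDist p x y ^ v ≤ c m := fun h =>
    Real.rpow_le_rpow (lpDist_nonneg p _ _) (lpDist_le hp (by positivity) h) hv.le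
  set X : (Fin d → Fin (2 ^ K)) → (Fin d → Fin (2 ^ K)) → Set ℝ := fun i j =>
    {r | ∃ x ∈ binSet d (2 ^ K) i, ∃ y ∈ binSet d (2 ^ K) j, r = lpDist p x y ^ v} with hX
  have hbound : ∀ m ≤ K, ∀ i j, coarseIndex K m i = coarseIndex K m j → ∀ r ∈ X i j, r ≤ c m := by
    rintro m hm i j h r ⟨x, hx, y, hy, rfl⟩
    exact hrpow (abs_sub_le_of_coarseIndex_eq hm h hx hy)
  have h0 : ∀ i j : Fin d → Fin (2 ^ K), coarseIndex K 0 i = coarseIndex K 0 j := fun i j => by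
    rw [coarseIndex_zero, coarseIndex_zero]
  obtain ⟨q, hq, hrow, hcol, hqc⟩ := exists_multiscale_coupling (coarseIndex (d := d) K) c hc0
    (fun i j => sSup (X i j)) K (fun m hm i j h => Real.sSup_le (hbound m hm i j h) (hc0 m))
    (fun m hm i j h => by
      funext l
      rw [coarseIndex_eq_div hm, coarseIndex_eq_div hm, h]) h0 w u hw hu (hw1.trans hu1.symm)
  have hX0 : ∀ i j, ∀ r ∈ X i j, 0 ≤ r := by
    rintro i j r ⟨x, -, y, -, rfl⟩
    exact Real.rpow_nonneg (lpDist_nonneg p _ _) _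
  have hcost : ∀ i j, ∀ x ∈ binSet d (2 ^ K) i, ∀ y ∈ binSet d (2 ^ K) j,
      lpDist p x y ^ v ≤ sSup (X i j) := by
    intro i j x hx y hy
    exact le_csSup ⟨c 0, hbound 0 (Nat.zero_le K) i j (h0 i j)⟩ ⟨x, hx, y, hy, rfl⟩
  have hW := wassersteinLp_histMeasure_le hv (Nat.two_pow_pos K) w u hw1 q
    (fun i j => sSup (X i j)) hq hrow hcol (fun i j => Real.sSup_nonneg (hX0 i j)) hcost
  refine hW.trans (Real.rpow_le_rpow (Finset.sum_nonneg fun i _ => Finset.sum_nonneg fun j _ =>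
    mul_nonneg (hq i j) (Real.sSup_nonneg (hX0 i j))) ?_ (by positivity))
  rw [hw1, mul_one] at hqc
  exact hqc

theorem gammaMeasure_moment {a : ℝ} (ha : 0 < a) (k : ℕ) :
    Integrable (fun x => x ^ k) (ProbabilityTheory.gammaMeasure a 1) ∧
      ∫ x, x ^ k ∂(ProbabilityTheory.gammaMeasure a 1) = Real.Gamma (a + k) / Real.Gamma a := by
  have hm : Measurable (ProbabilityTheory.gammaPDF a 1) :=
    (ProbabilityTheory.measurable_gammaPDFReal a 1).ennreal_ofReal
  have hlt : ∀ᵐ x ∂(volume : Measure ℝ), ProbabilityTheory.gammaPDF a 1 x < ∞ :=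
    ae_of_all _ fun x => ENNReal.ofReal_lt_top
  have hak : 0 < a + k := by positivity
  have hae : (fun x => (ProbabilityTheory.gammaPDF a 1 x).toReal • x ^ k) =ᵐ[volume]
      (Set.Ioi (0 : ℝ)).indicator
        fun x => Real.exp (-x) * x ^ (a + k - 1) / Real.Gamma a := by
    filter_upwards [volume.ae_ne (0 : ℝ)] with x hx
    rw [ProbabilityTheory.gammaPDF,
      ENNReal.toReal_ofReal (ProbabilityTheory.gammaPDFReal_nonneg ha one_pos x),
      ProbabilityTheory.gammaPDFReal]
    rcases lt_or_gt_of_ne hx with h | h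
    · rw [if_neg (not_le.2 h), Set.indicator_of_notMem (by simpa using h.le), zero_smul]
    · rw [if_pos h.le, Set.indicator_of_mem (by simpa using h), Real.one_rpow, one_mul,
        smul_eq_mul, show a + k - 1 = (a - 1) + k by ring, Real.rpow_add h, Real.rpow_natCast]
      ring
  have hint := (Real.GammaIntegral_convergent hak).div_const (Real.Gamma a)
  constructor
  · rw [ProbabilityTheory.gammaMeasure, integrable_withDensity_iff_integrable_smul' hm hlt,
      integrable_congr hae, integrable_indicator_iff measurableSet_Ioi]
    exact hint
  · rw [ProbabilityTheory.gammaMeasure, integral_withDensity_eq_integral_toReal_smul hm hlt,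
      integral_congr_ae hae, integral_indicator measurableSet_Ioi, integral_div,
      ← Real.Gamma_eq_integral hak]

theorem memLp_two_gammaMeasure {a : ℝ} (ha : 0 < a) :
    MemLp (fun x : ℝ => x) 2 (ProbabilityTheory.gammaMeasure a 1) :=
  (memLp_two_iff_integrable_sq measurable_id.aestronglyMeasurable).2 (gammaMeasure_moment ha 2).1

theorem integral_id_gammaMeasure {a : ℝ} (ha : 0 < a) :
    ∫ x, x ∂(ProbabilityTheory.gammaMeasure a 1) = a := by
  have := (gammaMeasure_moment ha 1).2
  simp only [pow_one, Nat.cast_one] at this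
  rw [this, Real.Gamma_add_one ha.ne', mul_div_assoc, div_self (Real.Gamma_pos_of_pos ha).ne',
    mul_one]

theorem variance_id_gammaMeasure {a : ℝ} (ha : 0 < a) :
    ProbabilityTheory.variance (fun x : ℝ => x) (ProbabilityTheory.gammaMeasure a 1) = a := by
  have := ProbabilityTheory.isProbabilityMeasure_gammaMeasure ha one_pos
  have h2 := (gammaMeasure_moment ha 2).2
  rw [ProbabilityTheory.variance_eq_sub (memLp_two_gammaMeasure ha), integral_id_gammaMeasure ha]
  simp only [Pi.pow_apply]
  rw [h2, Nat.cast_two, show a + 2 = (a + 1) + 1 by ring,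
    Real.Gamma_add_one (by positivity), Real.Gamma_add_one ha.ne']
  have := (Real.Gamma_pos_of_pos ha).ne'
  field_simp
  ring

theorem integral_abs_sub_mean_le {Ω : Type*} [MeasurableSpace Ω] {P : Measure Ω}
    [IsProbabilityMeasure P] {X : Ω → ℝ} (hX : MemLp X 2 P) :
    ∫ ω, |X ω - ∫ ω, X ω ∂P| ∂P ≤ √(ProbabilityTheory.variance X P) := by
  apply Real.le_sqrt_of_sq_le
  have hY : MemLp (fun ω => X ω - ∫ ω, X ω ∂P) 2 P := hX.sub (memLp_const _)
  have h := ProbabilityTheory.variance_nonneg (fun ω => |X ω - ∫ ω, X ω ∂P|) P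
  have hYa : MemLp (fun ω => |X ω - ∫ ω, X ω ∂P|) 2 P := hY.abs
  rw [ProbabilityTheory.variance_eq_sub hYa] at h
  simp only [Pi.pow_apply, sq_abs] at h
  rw [ProbabilityTheory.variance_eq_integral hX.aemeasurable]
  linarith

theorem pi_gammaMeasure_abs_sum_sub {ι : Type*} [Fintype ι] {β : ι → ℝ} (hβ : ∀ i, 0 < β i)
    (s : Finset ι) :
    Integrable (fun g : ι → ℝ => |∑ i ∈ s, g i - ∑ i ∈ s, β i|)
        (Measure.pi fun i => ProbabilityTheory.gammaMeasure (β i) 1) ∧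
      ∫ g : ι → ℝ, |∑ i ∈ s, g i - ∑ i ∈ s, β i|
        ∂(Measure.pi fun i => ProbabilityTheory.gammaMeasure (β i) 1) ≤ √(∑ i ∈ s, β i) := by
  have hprob := fun i => ProbabilityTheory.isProbabilityMeasure_gammaMeasure (hβ i) one_pos
  set P := Measure.pi fun i => ProbabilityTheory.gammaMeasure (β i) 1 with hP
  have hL : ∀ i, MemLp (fun g : ι → ℝ => g i) 2 P := fun i =>
    (memLp_two_gammaMeasure (hβ i)).comp_measurePreserving (measurePreserving_eval _ i)
  have hmean : ∀ i, ∫ g : ι → ℝ, g i ∂P = β i := fun i => by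
    have h := integral_comp_eval (μ := fun i => ProbabilityTheory.gammaMeasure (β i) 1) (i := i)
      (f := fun x : ℝ => x) measurable_id.aestronglyMeasurable
    rwa [integral_id_gammaMeasure (hβ i)] at h
  have hvar : ∀ i, ProbabilityTheory.variance (fun g : ι → ℝ => g i) P = β i := fun i => by
    have h := (measurePreserving_eval (fun i => ProbabilityTheory.gammaMeasure (β i) 1) i).map_eq
    have h' := ProbabilityTheory.variance_map (μ := P) (Y := Function.eval i)
      (X := fun x : ℝ => x) measurable_id.aemeasurable (measurable_pi_apply i).aemeasurable
    rw [h, variance_id_gammaMeasure (hβ i)] at h'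
    exact h'.symm
  have hsL : MemLp (fun g : ι → ℝ => ∑ i ∈ s, g i) 2 P := memLp_finsetSum s fun i _ => hL i
  have hsmean : ∫ g : ι → ℝ, ∑ i ∈ s, g i ∂P = ∑ i ∈ s, β i := by
    rw [integral_finsetSum s fun i _ => (hL i).integrable one_le_two]
    simp only [hmean]
  have hsvar : ProbabilityTheory.variance (fun g : ι → ℝ => ∑ i ∈ s, g i) P = ∑ i ∈ s, β i := by
    have h := ProbabilityTheory.IndepFun.variance_sum (s := s) (μ := P)
      (X := fun i (g : ι → ℝ) => g i) (fun i _ => hL i) fun i _ j _ hij =>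
        (ProbabilityTheory.iIndepFun_pi (X := fun _ (x : ℝ) => x)
          fun i => measurable_id.aemeasurable).indepFun hij
    simp only [hvar] at h
    rw [← h]
    congr 1
    funext g
    simp
  constructor
  · exact ((hsL.sub (memLp_const _)).integrable one_le_two).abs
  · have := integral_abs_sub_mean_le hsL
    rwa [hsmean, hsvar] at this

theorem sum_sqrt_le_sqrt_card_mul_sum {ι : Type*} (s : Finset ι) (x : ι → ℝ)
    (hx : ∀ i ∈ s, 0 ≤ x i) : ∑ i ∈ s, √(x i) ≤ √(s.card * ∑ i ∈ s, x i) := by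
  apply Real.le_sqrt_of_sq_le
  refine sq_sum_le_card_mul_sum_sq.trans_eq ?_
  congr 1
  exact Finset.sum_congr rfl fun i hi => Real.sq_sqrt (hx i hi)

theorem sum_abs_fiber_normalize_sub_le {I J : Type*} [Fintype I] [DecidableEq J] (f : I → J)
    (g β : I → ℝ) (hg : ∀ i, 0 ≤ g i / ∑ j, g j) (hg1 : ∑ i, g i / ∑ j, g j = 1)
    (hβ : 0 < ∑ i, β i) :
    ∑ Q ∈ Finset.univ.image f,
        |∑ i with f i = Q, g i / ∑ j, g j - ∑ i with f i = Q, β i / ∑ j, β j| ≤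
      2 / (∑ i, β i) *
        ∑ Q ∈ Finset.univ.image f, |∑ i with f i = Q, g i - ∑ i with f i = Q, β i| := by
  set S := ∑ i, g i with hS
  set A := ∑ i, β i with hA
  have hS0 : S ≠ 0 := by
    rintro h
    simp [h] at hg1
  have hmaps : ∀ i ∈ (Finset.univ : Finset I), f i ∈ Finset.univ.image f :=
    fun i _ => Finset.mem_image_of_mem f (Finset.mem_univ i)
  have hw1 : ∑ Q ∈ Finset.univ.image f, ∑ i with f i = Q, g i / S = 1 := by
    rw [Finset.sum_fiberwise_of_maps_to hmaps, hg1]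
  have hSA : |A - S| ≤
      ∑ Q ∈ Finset.univ.image f, |∑ i with f i = Q, g i - ∑ i with f i = Q, β i| := by
    rw [abs_sub_comm, hS, hA, ← Finset.sum_fiberwise_of_maps_to hmaps g,
      ← Finset.sum_fiberwise_of_maps_to hmaps β, ← Finset.sum_sub_distrib]
    exact Finset.abs_sum_le_sum_abs _ _
  have hQ : ∀ Q ∈ Finset.univ.image f,
      |∑ i with f i = Q, g i / S - ∑ i with f i = Q, β i / A| ≤
        1 / A * |∑ i with f i = Q, g i - ∑ i with f i = Q, β i| +
          (∑ i with f i = Q, g i / S) * (1 / A * |A - S|) := by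
    intro Q _
    have hw0 : 0 ≤ ∑ i with f i = Q, g i / S := Finset.sum_nonneg fun i _ => hg i
    have e : ∑ i with f i = Q, g i / S - ∑ i with f i = Q, β i / A =
        1 / A * (∑ i with f i = Q, g i - ∑ i with f i = Q, β i) +
          (∑ i with f i = Q, g i / S) * (1 / A * (A - S)) := by
      rw [← Finset.sum_div, ← Finset.sum_div]
      field_simp
      ring
    rw [e]
    refine (abs_add_le _ _).trans_eq ?_
    rw [abs_mul, abs_mul, abs_mul, abs_of_nonneg hw0, abs_of_pos (one_div_pos.2 hβ)]
  refine (Finset.sum_le_sum hQ).trans ?_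
  rw [Finset.sum_add_distrib, ← Finset.sum_mul, ← Finset.mul_sum, hw1, one_mul]
  have := mul_le_mul_of_nonneg_left hSA (one_div_pos.2 hβ).le
  calc _ ≤ _ := add_le_add_right this _
    _ = _ := by ring

/-- The bound on the expectation of `multiscaleBound` under a Dirichlet distribution with total
concentration `A`. -/
def expectedBound (p v : ℝ) (d K : ℕ) (A : ℝ) : ℝ :=
  ((d : ℝ) ^ (1 / p) * (1 / 2) ^ K) ^ v + ∑ m ∈ Finset.range K,
    ((d : ℝ) ^ (1 / p) * (1 / 2) ^ m) ^ v * (2 * √((2 ^ (m + 1)) ^ d / A))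

theorem isProbabilityMeasure_dirichlet {ι : Type*} [Fintype ι] {β : ι → ℝ} (hβ : ∀ i, 0 < β i) :
    IsProbabilityMeasure (dirichlet β) := by
  have hprob := fun i => ProbabilityTheory.isProbabilityMeasure_gammaMeasure (hβ i) one_pos
  exact Measure.isProbabilityMeasure_map (Measurable.aemeasurable (by fun_prop))

theorem dirichlet_multiscaleBound_ge_le (p v : ℝ) (d K : ℕ) {β : (Fin d → Fin (2 ^ K)) → ℝ}
    (hβ : ∀ i, 0 < β i) {t : ℝ} (ht : 0 < t) :
    ((dirichlet β) {w | (∀ j, 0 ≤ w j) ∧ (∑ j, w j = 1) ∧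
      t ≤ multiscaleBound p v d K w (fun i => β i / ∑ j, β j)}).toReal ≤
      expectedBound p v d K (∑ j, β j) / t := by
  have hprob := fun i => ProbabilityTheory.isProbabilityMeasure_gammaMeasure (hβ i) one_pos
  have hA : 0 < ∑ j, β j := Finset.sum_pos (fun i _ => hβ i) ⟨fun _ => ⟨0, by positivity⟩, by simp⟩
  set A := ∑ j, β j with hAdef
  set P := Measure.pi fun i => ProbabilityTheory.gammaMeasure (β i) 1 with hP
  set c : ℕ → ℝ := fun m => ((d : ℝ) ^ (1 / p) * (1 / 2) ^ m) ^ v with hc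
  have hc0 : ∀ m, 0 ≤ c m := fun m => by positivity
  set F : ((Fin d → Fin (2 ^ K)) → ℝ) → ℝ := fun g => c K + ∑ m ∈ Finset.range K, c m *
    (2 / A * ∑ Q ∈ Finset.univ.image (coarseIndex (d := d) K (m + 1)),
      |∑ i with coarseIndex K (m + 1) i = Q, g i - ∑ i with coarseIndex K (m + 1) i = Q, β i|)
    with hF
  have hF0 : ∀ g, 0 ≤ F g := fun g => add_nonneg (hc0 K) (Finset.sum_nonneg fun m _ =>
    mul_nonneg (hc0 m) (mul_nonneg (by positivity) (Finset.sum_nonneg fun Q _ => abs_nonneg _)))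
  have hi1 : ∀ m, Integrable (fun g : (Fin d → Fin (2 ^ K)) → ℝ =>
      ∑ Q ∈ Finset.univ.image (coarseIndex (d := d) K (m + 1)),
      |∑ i with coarseIndex K (m + 1) i = Q, g i - ∑ i with coarseIndex K (m + 1) i = Q, β i|) P :=
    fun m => integrable_finsetSum _ fun Q _ => (pi_gammaMeasure_abs_sum_sub hβ _).1
  have hi2 : Integrable (fun g => ∑ m ∈ Finset.range K, c m *
    (2 / A * ∑ Q ∈ Finset.univ.image (coarseIndex (d := d) K (m + 1)),
      |∑ i with coarseIndex K (m + 1) i = Q, g i -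
        ∑ i with coarseIndex K (m + 1) i = Q, β i|)) P :=
    integrable_finsetSum _ fun m _ => ((hi1 m).const_mul _).const_mul _
  have hFi : Integrable F P := (integrable_const _).add hi2
  have hFE : ∫ g, F g ∂P ≤ expectedBound p v d K A := by
    rw [hF, integral_add (integrable_const _) hi2, integral_const, probReal_univ, one_smul,
      integral_finsetSum _ fun m _ => ((hi1 m).const_mul _).const_mul _]
    refine add_le_add_right (Finset.sum_le_sum fun m hm => ?_) _
    rw [integral_const_mul, integral_const_mul]
    refine mul_le_mul_of_nonneg_left ?_ (hc0 m)
    rw [integral_finsetSum _ fun Q _ => (pi_gammaMeasure_abs_sum_sub hβ _).1]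
    have h1 : ∑ Q ∈ Finset.univ.image (coarseIndex (d := d) K (m + 1)),
        ∫ g : (Fin d → Fin (2 ^ K)) → ℝ, |∑ i with coarseIndex K (m + 1) i = Q, g i -
          ∑ i with coarseIndex K (m + 1) i = Q, β i| ∂P ≤ √((2 ^ (m + 1)) ^ d * A) := by
      refine (Finset.sum_le_sum fun Q _ => (pi_gammaMeasure_abs_sum_sub hβ _).2).trans ?_
      refine (sum_sqrt_le_sqrt_card_mul_sum _ _ fun Q _ =>
        Finset.sum_nonneg fun i _ => (hβ i).le).trans (Real.sqrt_le_sqrt ?_)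
      rw [Finset.sum_fiberwise_of_maps_to
        (fun i _ => Finset.mem_image_of_mem _ (Finset.mem_univ i))]
      refine mul_le_mul_of_nonneg_right ?_ hA.le
      have := card_image_coarseIndex_le d (show m + 1 ≤ K by have := Finset.mem_range.1 hm; omega)
      exact_mod_cast this
    refine (mul_le_mul_of_nonneg_left h1 (by positivity)).trans_eq ?_
    rw [Real.sqrt_mul (by positivity), Real.sqrt_div (by positivity)]
    have h2 : √A * √A = A := Real.mul_self_sqrt hA.le
    have h3 : 0 < √A := Real.sqrt_pos.2 hA
    field_simp
    rw [sq, h2]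
  have hmeas : MeasurableSet {w : (Fin d → Fin (2 ^ K)) → ℝ | (∀ j, 0 ≤ w j) ∧ (∑ j, w j = 1) ∧
      t ≤ multiscaleBound p v d K w (fun i => β i / A)} := by
    have hB : Measurable fun w => multiscaleBound p v d K w (fun i => β i / A) := by
      unfold multiscaleBound
      simp only [← Real.norm_eq_abs]
      fun_prop
    refine MeasurableSet.inter ?_ (MeasurableSet.inter ?_ ?_)
    · change MeasurableSet {w : (Fin d → Fin (2 ^ K)) → ℝ | ∀ j, 0 ≤ w j}
      rw [Set.ofPred_forall]
      exact MeasurableSet.iInter fun j => measurableSet_le measurable_const (measurable_pi_apply j)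
    · exact measurableSet_eq_fun (by fun_prop) measurable_const
    · exact measurableSet_le measurable_const hB
  rw [dirichlet, Measure.map_apply (by fun_prop) hmeas]
  have hsub : (fun (g : (Fin d → Fin (2 ^ K)) → ℝ) i => g i / ∑ j, g j) ⁻¹'
      {w | (∀ j, 0 ≤ w j) ∧ (∑ j, w j = 1) ∧
        t ≤ multiscaleBound p v d K w (fun i => β i / A)} ⊆ {g | t ≤ F g} := by
    rintro g ⟨h1, h2, h3⟩
    refine h3.trans (add_le_add_right (Finset.sum_le_sum fun m _ =>
      mul_le_mul_of_nonneg_left ?_ (hc0 m)) _)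
    exact sum_abs_fiber_normalize_sub_le (coarseIndex K (m + 1)) g β h1 h2 hA
  have hmarkov := mul_meas_ge_le_integral_of_nonneg (ae_of_all P hF0) hFi t
  rw [le_div_iff₀ ht, mul_comm]
  refine le_trans ?_ (hmarkov.trans hFE)
  exact mul_le_mul_of_nonneg_left (measureReal_mono hsub) ht.le

theorem existsUnique_mem_binSet {d b : ℕ} (hb : 0 < b) {x : Fin d → ℝ} (hx : x ∈ cube d) :
    ∃! j, x ∈ binSet d b j := by
  have hb' : (0 : ℝ) < b := by exact_mod_cast hb
  have h0 : ∀ l, 0 ≤ x l * b := fun l => mul_nonneg (hx l).1 hb'.le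
  refine ⟨fun l => ⟨⌊x l * b⌋₊, (Nat.floor_lt (h0 l)).2 ?_⟩, fun l => ⟨?_, ?_⟩, ?_⟩
  · nlinarith [(hx l).2]
  · exact (div_le_iff₀ hb').2 (Nat.floor_le (h0 l))
  · exact (lt_div_iff₀ hb').2 (Nat.lt_floor_add_one _)
  · intro j hj
    funext l
    apply Fin.ext
    refine ((Nat.floor_eq_iff (h0 l)).2 ⟨?_, ?_⟩).symm
    · exact (div_le_iff₀ hb').1 (hj l).1
    · exact (lt_div_iff₀ hb').1 (hj l).2

theorem sum_binCount {d b n : ℕ} (hb : 0 < b) {Y : Fin n → Fin d → ℝ} (hY : ∀ t, Y t ∈ cube d) :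
    ∑ j, binCount d b Y j = n := by
  simp only [binCount, Finset.card_filter]
  rw [Finset.sum_comm]
  have : ∀ t, ∑ j, (if Y t ∈ binSet d b j then 1 else 0) = 1 := by
    intro t
    obtain ⟨j, hj, huniq⟩ := existsUnique_mem_binSet hb (hY t)
    rw [Finset.sum_eq_single j]
    · exact if_pos hj
    · exact fun i _ hi => if_neg fun h => hi (huniq i h)
    · simp
  simp [this]

theorem expectedBound_anti (p v : ℝ) (d K : ℕ) {A B : ℝ} (hA : 0 < A) (hAB : A ≤ B) :
    expectedBound p v d K B ≤ expectedBound p v d K A := by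
  unfold expectedBound
  gcongr

theorem posterior_mass_le {p v : ℝ} (hp : 0 < p) (hv : 0 < v) {d K n : ℕ} (hn : 0 < n)
    {α : (Fin d → Fin (2 ^ K)) → ℝ} (hα : ∀ j, 0 < α j) {Y : Fin n → Fin d → ℝ}
    (hY : ∀ t, Y t ∈ cube d) {τ : ℝ} (hτ : 0 < τ) :
    ((dirichlet fun j => α j + (binCount d (2 ^ K) Y j : ℝ))
      {w | (∀ j, 0 ≤ w j) ∧ (∑ j, w j = 1) ∧ τ ≤ wassersteinLp p v (histMeasure d (2 ^ K) w)
        (histMeasure d (2 ^ K) (postWeight d (2 ^ K) α Y))}).toReal ≤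
      expectedBound p v d K n / τ ^ v := by
  set β : (Fin d → Fin (2 ^ K)) → ℝ := fun j => α j + (binCount d (2 ^ K) Y j : ℝ) with hβdef
  have hβ : ∀ j, 0 < β j := fun j => add_pos_of_pos_of_nonneg (hα j) (Nat.cast_nonneg _)
  have hsum : ∑ j, β j = n + ∑ j, α j := by
    rw [hβdef, Finset.sum_add_distrib, ← Nat.cast_sum, sum_binCount (Nat.two_pow_pos K) hY,
      add_comm]
  have hn' : (0 : ℝ) < n := by exact_mod_cast hn
  have hle : (n : ℝ) ≤ ∑ j, β j := by
    rw [hsum]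
    exact le_add_of_nonneg_right (Finset.sum_nonneg fun j _ => (hα j).le)
  have hA : 0 < ∑ j, β j := hn'.trans_le hle
  have hu : postWeight d (2 ^ K) α Y = fun j => β j / ∑ i, β i := by
    funext j
    rw [postWeight, hsum]
  have := isProbabilityMeasure_dirichlet hβ
  have hsub : {w | (∀ j, 0 ≤ w j) ∧ (∑ j, w j = 1) ∧ τ ≤ wassersteinLp p v
      (histMeasure d (2 ^ K) w) (histMeasure d (2 ^ K) (postWeight d (2 ^ K) α Y))} ⊆
      {w | (∀ j, 0 ≤ w j) ∧ (∑ j, w j = 1) ∧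
        τ ^ v ≤ multiscaleBound p v d K w (fun i => β i / ∑ j, β j)} := by
    rintro w ⟨h1, h2, h3⟩
    refine ⟨h1, h2, ?_⟩
    rw [hu] at h3
    have hW := h3.trans (wassersteinLp_le_multiscaleBound hp hv d K w (fun i => β i / ∑ j, β j)
      h1 (fun i => div_nonneg (hβ i).le hA.le) h2 (by rw [← Finset.sum_div, div_self hA.ne']))
    have hpow := Real.rpow_le_rpow hτ.le hW hv.le
    rwa [← Real.rpow_mul (multiscaleBound_nonneg _ _ _ _ _ _), one_div_mul_cancel hv.ne',
      Real.rpow_one] at hpow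
  refine (measureReal_mono hsub).trans ?_
  refine (dirichlet_multiscaleBound_ge_le p v d K hβ (by positivity)).trans ?_
  exact div_le_div_of_nonneg_right (expectedBound_anti p v d K hn' hle) (by positivity)

theorem expectedBound_eq (p v : ℝ) (d K : ℕ) {A : ℝ} :
    expectedBound p v d K A = ((d : ℝ) ^ (1 / p)) ^ v * (((2 : ℝ) ^ K) ^ (-v) +
      2 * 2 ^ ((d : ℝ) / 2) * (∑ m ∈ Finset.range K, ((2 : ℝ) ^ ((d : ℝ) / 2 - v)) ^ m) *
        (√A)⁻¹) := by
  have h1 : ∀ m : ℕ, ((d : ℝ) ^ (1 / p) * (1 / 2) ^ m) ^ v =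
      ((d : ℝ) ^ (1 / p)) ^ v * ((2 : ℝ) ^ m) ^ (-v) := by
    intro m
    rw [Real.mul_rpow (by positivity) (by positivity), one_div (2 : ℝ), inv_pow,
      Real.inv_rpow (by positivity), Real.rpow_neg (by positivity)]
  have h2 : ∀ m : ℕ, √(((2 : ℝ) ^ (m + 1)) ^ d / A) =
      2 ^ ((d : ℝ) / 2) * ((2 : ℝ) ^ m) ^ ((d : ℝ) / 2) * (√A)⁻¹ := by
    intro m
    rw [Real.sqrt_div (by positivity), div_eq_mul_inv, Real.sqrt_eq_rpow, ← Real.rpow_natCast _ d,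
      ← Real.rpow_mul (by positivity), pow_succ, mul_one_div,
      Real.mul_rpow (by positivity) (by positivity), mul_comm ((2 : ℝ) ^ ((d : ℝ) / 2))]
  have h3 : ∀ m : ℕ, ((2 : ℝ) ^ ((d : ℝ) / 2 - v)) ^ m =
      ((2 : ℝ) ^ m) ^ (-v) * ((2 : ℝ) ^ m) ^ ((d : ℝ) / 2) := by
    intro m
    rw [← Real.rpow_add (by positivity), ← Real.rpow_natCast, ← Real.rpow_natCast,
      ← Real.rpow_mul (by positivity), ← Real.rpow_mul (by positivity)]
    congr 1
    ring
  simp only [expectedBound, h1, h2, h3, Finset.mul_sum, Finset.sum_mul, mul_add]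
  congr 1
  exact Finset.sum_congr rfl fun m _ => by ring

theorem one_le_kSeq (d : ℕ) {v : ℝ} (hv : 0 < v) {n : ℕ} (hn : 1 ≤ n) : 1 ≤ kSeq d v n := by
  have hn' : (1 : ℝ) ≤ n := by exact_mod_cast hn
  unfold kSeq
  split_ifs <;> exact Real.one_le_rpow hn' (by positivity)

theorem kSeq_le_two_pow (d : ℕ) {v : ℝ} (hv : 0 < v) {n : ℕ} (hn : 1 ≤ n) :
    kSeq d v n ≤ 2 ^ KSeq d v n := by
  have hk := one_le_kSeq d hv hn
  rw [← Real.rpow_natCast, ← Real.logb_le_iff_le_rpow one_lt_two (by linarith)]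
  exact Nat.le_ceil _

theorem KSeq_le (d : ℕ) {v : ℝ} (hv : 0 < v) {n : ℕ} (hn : 1 ≤ n) :
    (KSeq d v n : ℝ) ≤ Real.logb 2 (kSeq d v n) + 1 :=
  (Nat.ceil_lt_add_one (Real.logb_nonneg one_lt_two (one_le_kSeq d hv hn))).le

theorem two_pow_le_two_mul_kSeq (d : ℕ) {v : ℝ} (hv : 0 < v) {n : ℕ} (hn : 1 ≤ n) :
    2 ^ KSeq d v n ≤ 2 * kSeq d v n := by
  have hk := one_le_kSeq d hv hn
  rw [← Real.rpow_natCast]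
  refine (Real.rpow_le_rpow_of_exponent_le one_le_two (KSeq_le d hv hn)).trans_eq ?_
  rw [Real.rpow_add two_pos, Real.rpow_logb two_pos (by norm_num) (by linarith), Real.rpow_one,
    mul_comm]

/-- The order of the expected `v`-th power of the Wasserstein distance. -/
def rateSeq (d : ℕ) (v : ℝ) (n : ℕ) : ℝ :=
  if (d : ℝ) < 2 * v then (n : ℝ) ^ (-(1 / 2) : ℝ)
  else if (d : ℝ) = 2 * v then (n : ℝ) ^ (-(1 / 2) : ℝ) * Real.log n
  else (n : ℝ) ^ (-(v / d))

theorem one_le_log_natCast {n : ℕ} (hn : 3 ≤ n) : 1 ≤ Real.log n := by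
  rw [Real.le_log_iff_exp_le (by positivity)]
  have h3 : (3 : ℝ) ≤ n := by exact_mod_cast hn
  linarith [Real.exp_one_lt_d9]

theorem exists_expectedBound_le_rateSeq (p : ℝ) {v : ℝ} (hv : 0 < v) (d : ℕ) :
    ∃ M, ∀ n : ℕ, 3 ≤ n → expectedBound p v d (KSeq d v n) n ≤ M * rateSeq d v n := by
  set D := ((d : ℝ) ^ (1 / p)) ^ v with hD
  set s := (2 : ℝ) ^ ((d : ℝ) / 2) with hs
  set ρ := (2 : ℝ) ^ ((d : ℝ) / 2 - v) with hρ
  have hD0 : 0 ≤ D := by positivity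
  have hs0 : 0 < s := by positivity
  have hρ0 : 0 < ρ := by positivity
  have hsqrt : ∀ n : ℕ, (√(n : ℝ))⁻¹ = (n : ℝ) ^ (-(1 / 2) : ℝ) := fun n => by
    rw [Real.sqrt_eq_rpow, Real.rpow_neg (Nat.cast_nonneg n)]
  have hbias : ∀ n : ℕ, 3 ≤ n → ((2 : ℝ) ^ KSeq d v n) ^ (-v) ≤ kSeq d v n ^ (-v) := fun n hn =>
    Real.rpow_le_rpow_of_nonpos (zero_lt_one.trans_le (one_le_kSeq d hv (by omega)))
      (kSeq_le_two_pow d hv (by omega)) (by linarith)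
  have hbias' : (d : ℝ) ≤ 2 * v → ∀ n : ℕ, kSeq d v n ^ (-v) = (n : ℝ) ^ (-(1 / 2) : ℝ) := by
    intro h n
    rw [kSeq, if_pos h, ← Real.rpow_mul (Nat.cast_nonneg n)]
    congr 1
    field_simp
  rcases lt_trichotomy (d : ℝ) (2 * v) with h | h | h
  · have hρ1 : ρ < 1 := Real.rpow_lt_one_of_one_lt_of_neg one_lt_two (by linarith)
    refine ⟨D * (1 + 2 * s * (1 - ρ)⁻¹), fun n hn => ?_⟩
    rw [expectedBound_eq, rateSeq, if_pos h, hsqrt, mul_assoc D]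
    refine mul_le_mul_of_nonneg_left ?_ hD0
    rw [add_mul, one_mul]
    refine add_le_add ((hbias n hn).trans_eq (hbias' h.le n)) ?_
    gcongr
    rw [geom_sum_eq hρ1.ne, ← neg_div_neg_eq, neg_sub, neg_sub, ← one_div]
    exact div_le_div_of_nonneg_right (by linarith [pow_pos hρ0 (KSeq d v n)]) (by linarith)
  · have hρ1 : ρ = 1 := by
      rw [hρ, h]
      ring_nf
      exact Real.rpow_zero 2
    refine ⟨D * (1 + 2 * s * (1 / (2 * v * Real.log 2) + 1)), fun n hn => ?_⟩
    have hlog := one_le_log_natCast hn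
    have hlog2 : 0 < Real.log 2 := Real.log_pos one_lt_two
    have hK := KSeq_le d hv (show 1 ≤ n by omega)
    rw [kSeq, if_pos h.le, Real.logb, Real.log_rpow (by positivity)] at hK
    rw [expectedBound_eq, rateSeq, if_neg h.not_lt, if_pos h, hsqrt, mul_assoc D]
    refine mul_le_mul_of_nonneg_left ?_ hD0
    rw [add_mul, one_mul]
    refine add_le_add (((hbias n hn).trans_eq (hbias' h.le n)).trans
      (le_mul_of_one_le_right (by positivity) hlog)) ?_
    simp only [← hρ, hρ1, one_pow, Finset.sum_const, Finset.card_range, nsmul_eq_mul, mul_one]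
    have : (KSeq d v n : ℝ) ≤ (1 / (2 * v * Real.log 2) + 1) * Real.log n := by
      refine hK.trans ?_
      rw [add_mul, one_mul]
      refine add_le_add (le_of_eq ?_) hlog
      field_simp
    calc 2 * s * (KSeq d v n : ℝ) * (n : ℝ) ^ (-(1 / 2) : ℝ)
        ≤ 2 * s * ((1 / (2 * v * Real.log 2) + 1) * Real.log n) * (n : ℝ) ^ (-(1 / 2) : ℝ) := by
          gcongr
      _ = _ := by ring
  · have hρ1 : 1 < ρ := Real.one_lt_rpow one_lt_two (by linarith)
    have hd : (0 : ℝ) < d := by linarith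
    refine ⟨D * (1 + 2 * s * (ρ / (ρ - 1))), fun n hn => ?_⟩
    have hn0 : (0 : ℝ) < n := by positivity
    have hk : kSeq d v n = (n : ℝ) ^ ((1 : ℝ) / d) := if_neg h.not_ge
    rw [expectedBound_eq, rateSeq, if_neg (not_lt.2 h.le), if_neg h.ne', hsqrt, mul_assoc D]
    refine mul_le_mul_of_nonneg_left ?_ hD0
    rw [add_mul, one_mul]
    refine add_le_add ((hbias n hn).trans_eq ?_) ?_
    · rw [hk, ← Real.rpow_mul hn0.le]
      congr 1
      ring
    · have hpow : ρ ^ KSeq d v n ≤ ρ * (n : ℝ) ^ (1 / 2 - v / d) := by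
        have e : ρ ^ KSeq d v n = ((2 : ℝ) ^ KSeq d v n) ^ ((d : ℝ) / 2 - v) := by
          rw [hρ, ← Real.rpow_natCast, ← Real.rpow_natCast, ← Real.rpow_mul two_pos.le,
            ← Real.rpow_mul two_pos.le, mul_comm]
        rw [e]
        refine (Real.rpow_le_rpow (by positivity) (two_pow_le_two_mul_kSeq d hv (by omega))
          (by linarith)).trans_eq ?_
        rw [hk, Real.mul_rpow two_pos.le (by positivity), ← Real.rpow_mul hn0.le]
        congr 2
        field_simp
      have hgeom : ∑ m ∈ Finset.range (KSeq d v n), ρ ^ m ≤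
          ρ / (ρ - 1) * (n : ℝ) ^ (1 / 2 - v / d) := by
        rw [geom_sum_eq hρ1.ne', div_mul_eq_mul_div]
        refine div_le_div_of_nonneg_right ?_ (by linarith)
        linarith
      calc 2 * s * (∑ m ∈ Finset.range (KSeq d v n), ρ ^ m) * (n : ℝ) ^ (-(1 / 2) : ℝ)
          ≤ 2 * s * (ρ / (ρ - 1) * (n : ℝ) ^ (1 / 2 - v / d)) * (n : ℝ) ^ (-(1 / 2) : ℝ) := by
            gcongr
        _ = 2 * s * (ρ / (ρ - 1)) *
            ((n : ℝ) ^ (1 / 2 - v / d) * (n : ℝ) ^ (-(1 / 2) : ℝ)) := by ring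
        _ = _ := by
            rw [← Real.rpow_add hn0]
            congr 2
            ring

theorem ae_pi_mem_cube {d : ℕ} {P₀ : Measure (Fin d → ℝ)} [IsProbabilityMeasure P₀]
    (hsupp : P₀ (cube d) = 1) (n : ℕ) :
    ∀ᵐ Y ∂(Measure.pi fun _ : Fin n => P₀), ∀ t, Y t ∈ cube d := by
  have hmeas : MeasurableSet (cube d) := by
    have : cube d = Set.pi Set.univ fun _ => Set.Ico (0 : ℝ) 1 := by
      ext x
      simp [cube]
    rw [this]
    exact MeasurableSet.univ_pi fun _ => measurableSet_Ico
  rw [ae_all_iff]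
  intro t
  have h : ∀ᵐ y ∂P₀, y ∈ cube d := (prob_compl_eq_zero_iff hmeas).2 hsupp
  exact (Measure.quasiMeasurePreserving_eval (fun _ : Fin n => P₀) t).ae h

/-- posterior contraction around the posterior mean histogram P̄_n at rate τ_n:
the expected posterior (Dirichlet) mass of {π : W_v(Histogram(π,b_n), P̄_n) ≥ τ_n} tends to 0. -/
theorem posterior_contraction_around_posterior_mean
    (d : ℕ) (hd : 1 ≤ d) (p v γ : ℝ) (hp : 1 ≤ p) (hv : 1 ≤ v) (hγ : 1 < γ)
    (α : ∀ n : ℕ, (Fin d → Fin (bSeq d v n)) → ℝ)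
    (hα : ∀ n j, 0 < α n j)
    (C₄ C₅ C₆ : ℝ)
    (hC₄ : (d : ℝ) < 2 * v →
      C₄ > (1 / 2) * ((2 : ℝ) ^ ((d : ℝ) / 2 - v) / (1 - (2 : ℝ) ^ ((d : ℝ) / 2 - v))) ^ (1 / v) *
        (2 : ℝ) ^ (1 / v) * (d : ℝ) ^ (1 / p))
    (hC₅ : (d : ℝ) = 2 * v →
      C₅ > (1 / 2) * (2 / ((d : ℝ) * Real.log 2)) ^ (1 / v) *
        (2 : ℝ) ^ (1 / v) * (d : ℝ) ^ (1 / p))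
    (hC₆ : (d : ℝ) > 2 * v →
      C₆ > (1 / 2) * ((2 : ℝ) ^ (2 * ((d : ℝ) / 2 - v)) / ((2 : ℝ) ^ ((d : ℝ) / 2 - v) - 1)) ^ (1 / v) *
        (2 : ℝ) ^ (1 / v) * (d : ℝ) ^ (1 / p))
    (τ : ℕ → ℝ)
    (hτ : ∀ n : ℕ, τ n =
      if (d : ℝ) < 2 * v then C₄ * (n : ℝ) ^ (-(1 / (2 * v))) * Real.log n ^ (γ / v)
      else if (d : ℝ) = 2 * v then C₅ * (n : ℝ) ^ (-(1 / (2 * v))) * Real.log n ^ ((1 + γ) / v)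
      else C₆ * (n : ℝ) ^ (-(1 / (d : ℝ))) * Real.log n ^ (γ / v))
    (P₀ : Measure (Fin d → ℝ)) (hP₀ : IsProbabilityMeasure P₀) (hsupp : P₀ (cube d) = 1) :
    Tendsto
      (fun n : ℕ =>
        ∫ Y, ((dirichlet fun j => α n j + (binCount d (bSeq d v n) Y j : ℝ))
            {w : (Fin d → Fin (bSeq d v n)) → ℝ |
              (∀ j, 0 ≤ w j) ∧ (∑ j, w j = 1) ∧
              τ n ≤ wassersteinLp p v (histMeasure d (bSeq d v n) w) (postMeanHist d v (α n) Y)}).toReal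
          ∂(Measure.pi fun _ : Fin n => P₀))
      atTop (nhds 0) := by
  have hp0 : 0 < p := by linarith
  have hv0 : 0 < v := by linarith
  have hd0 : (0 : ℝ) < d := by exact_mod_cast hd
  obtain ⟨M, hM⟩ := exists_expectedBound_le_rateSeq p hv0 d
  obtain ⟨C, hC, hτC⟩ : ∃ C : ℝ, 0 < C ∧ ∀ n : ℕ, 3 ≤ n →
      0 < τ n ∧ τ n ^ v = C * (rateSeq d v n * Real.log n ^ γ) := by
    have key : ∀ (C a b : ℝ), 0 < C → ∀ n : ℕ, 3 ≤ n →
        0 < C * (n : ℝ) ^ a * Real.log n ^ b ∧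
        (C * (n : ℝ) ^ a * Real.log n ^ b) ^ v =
          C ^ v * ((n : ℝ) ^ (a * v) * Real.log n ^ (b * v)) := by
      intro C a b hC n hn
      have hlog : 0 < Real.log n := zero_lt_one.trans_le (one_le_log_natCast hn)
      have hn0 : (0 : ℝ) < n := by positivity
      refine ⟨by positivity, ?_⟩
      rw [Real.mul_rpow (by positivity) (by positivity),
        Real.mul_rpow (by positivity) (by positivity), ← Real.rpow_mul hn0.le,
        ← Real.rpow_mul hlog.le, mul_assoc]
    have hexp : ∀ a : ℝ, a / v * v = a := fun a => div_mul_cancel₀ a hv0.ne'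
    rcases lt_trichotomy (d : ℝ) (2 * v) with h | h | h
    · have hρ1 : (2 : ℝ) ^ ((d : ℝ) / 2 - v) < 1 :=
        Real.rpow_lt_one_of_one_lt_of_neg one_lt_two (by linarith)
      have hC₄' : 0 < C₄ := by
        refine lt_of_le_of_lt ?_ (hC₄ h)
        have := sub_pos.2 hρ1
        positivity
      refine ⟨C₄ ^ v, by positivity, fun n hn => ?_⟩
      rw [hτ, if_pos h, rateSeq, if_pos h]
      refine ⟨(key C₄ _ _ hC₄' n hn).1, ?_⟩
      rw [(key C₄ _ _ hC₄' n hn).2, hexp]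
      congr 3
      field_simp
    · have hC₅' : 0 < C₅ := by
        refine lt_of_le_of_lt ?_ (hC₅ h)
        have := Real.log_pos one_lt_two
        positivity
      refine ⟨C₅ ^ v, by positivity, fun n hn => ?_⟩
      have hlog : 0 < Real.log n := zero_lt_one.trans_le (one_le_log_natCast hn)
      rw [hτ, if_neg h.not_lt, if_pos h, rateSeq, if_neg h.not_lt, if_pos h]
      refine ⟨(key C₅ _ _ hC₅' n hn).1, ?_⟩
      rw [(key C₅ _ _ hC₅' n hn).2, hexp, Real.rpow_add hlog, Real.rpow_one, mul_assoc (_ ^ _)]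
      congr 3
      field_simp
    · have hρ1 : 1 < (2 : ℝ) ^ ((d : ℝ) / 2 - v) := Real.one_lt_rpow one_lt_two (by linarith)
      have hC₆' : 0 < C₆ := by
        refine lt_of_le_of_lt ?_ (hC₆ h)
        have := sub_pos.2 hρ1
        positivity
      refine ⟨C₆ ^ v, by positivity, fun n hn => ?_⟩
      rw [hτ, if_neg (not_lt.2 h.le), if_neg h.ne', rateSeq, if_neg (not_lt.2 h.le), if_neg h.ne']
      refine ⟨(key C₆ _ _ hC₆' n hn).1, ?_⟩
      rw [(key C₆ _ _ hC₆' n hn).2, hexp]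
      congr 3
      field_simp
  have hlim : Tendsto (fun n : ℕ => M / C * (Real.log n ^ γ)⁻¹) atTop (nhds 0) := by
    have h := (tendsto_rpow_atTop (show 0 < γ by linarith)).comp
      (Real.tendsto_log_atTop.comp tendsto_natCast_atTop_atTop)
    simpa using (tendsto_inv_atTop_zero.comp h).const_mul (M / C)
  refine squeeze_zero' (Eventually.of_forall fun n => integral_nonneg fun Y =>
    ENNReal.toReal_nonneg) ?_ hlim
  filter_upwards [eventually_ge_atTop 3] with n hn
  obtain ⟨hτ0, hτv⟩ := hτC n hn
  have hτv0 : 0 < τ n ^ v := Real.rpow_pos_of_pos hτ0 v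
  have hlogγ : 0 < Real.log n ^ γ :=
    Real.rpow_pos_of_pos (zero_lt_one.trans_le (one_le_log_natCast hn)) γ
  have hr : 0 < rateSeq d v n := by
    rw [hτv] at hτv0
    exact pos_of_mul_pos_left (pos_of_mul_pos_right hτv0 hC.le) hlogγ.le
  have hbound : ∀ᵐ Y ∂(Measure.pi fun _ : Fin n => P₀),
      ‖((dirichlet fun j => α n j + (binCount d (bSeq d v n) Y j : ℝ))
        {w : (Fin d → Fin (bSeq d v n)) → ℝ | (∀ j, 0 ≤ w j) ∧ (∑ j, w j = 1) ∧
          τ n ≤ wassersteinLp p v (histMeasure d (bSeq d v n) w)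
            (postMeanHist d v (α n) Y)}).toReal‖ ≤ M / C * (Real.log n ^ γ)⁻¹ := by
    filter_upwards [ae_pi_mem_cube hsupp n] with Y hY
    rw [Real.norm_of_nonneg ENNReal.toReal_nonneg]
    refine (posterior_mass_le hp0 hv0 (by omega) (hα n) hY hτ0).trans ?_
    refine (div_le_div_of_nonneg_right (hM n hn) hτv0.le).trans_eq ?_
    rw [hτv]
    field_simp
  have h := norm_integral_le_of_norm_le_const hbound
  rw [probReal_univ, mul_one] at h
  exact (le_abs_self _).trans h

end
end

section
/- Let (Ω, ρ) be a metric space of finite diameter, and let K be a positive integer. Let {S_k}_{k=0}^{K} be a nested sequence of partitions of Ω into finitely many Borel sets, with S₀ = {Ω}; nested means that for each 1 ≤ k ≤ K, every member of S_k is contained in some member of S_{k−1}. Then for every 1 ≤ v < ∞ and all Borel probability measures μ, ν on Ω: W_v^v(μ,ν) ≤ Res(S_K)^v + Σ_{k=1}^{K} Res(S_{k−1})^v · Σ_{S ∈ S_k} |μ(S) − ν(S)|. -/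
open MeasureTheory Filter
open scoped ENNReal NNReal Classical BigOperators

noncomputable section

/-- Wasserstein-v distance on a metric measurable space, via couplings. -/
def wassersteinMetric {Ω : Type*} [MetricSpace Ω] [MeasurableSpace Ω] (v : ℝ)
    (μ ν : Measure Ω) : ℝ :=
  sInf { r : ℝ | ∃ π : Measure (Ω × Ω),
      IsProbabilityMeasure π ∧ π.map Prod.fst = μ ∧ π.map Prod.snd = ν ∧
      r = ∫ z, dist z.1 z.2 ^ v ∂π } ^ (1 / v)

/-- Resolution of a finite collection of sets: the largest diameter of a member. -/
def partitionRes {Ω : Type*} [MetricSpace Ω] (𝒮 : Finset (Set Ω)) : ℝ :=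
  sSup (Metric.diam '' (𝒮 : Set (Set Ω)))

/-- The sum of the restrictions of a measure to disjoint measurable sets is at most the measure. -/
theorem sum_restrict_le {Ω : Type*} [MeasurableSpace Ω] (P : Finset (Set Ω))
    (hm : ∀ A ∈ P, MeasurableSet A) (hd : (P : Set (Set Ω)).PairwiseDisjoint id)
    (μ : Measure Ω) : ∑ A ∈ P, μ.restrict A ≤ μ := by
  refine Measure.le_iff.2 fun s hs => ?_
  rw [Measure.finsetSum_apply]
  calc ∑ A ∈ P, μ.restrict A s = ∑ A ∈ P, μ (s ∩ A) :=
        Finset.sum_congr rfl fun A _ => Measure.restrict_apply hs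
    _ = μ (⋃ A ∈ P, s ∩ A) := by
        refine (measure_biUnion_finset (fun A hA B hB hAB => ?_)
          fun A hA => hs.inter (hm A hA)).symm
        exact (hd hA hB hAB).mono Set.inter_subset_right Set.inter_subset_right
    _ ≤ μ s := measure_mono (Set.iUnion₂_subset fun A _ => Set.inter_subset_left)

/-- A partial coupling of two finite measures that moves mass only inside the blocks of a
partition and exhausts one of the two measures on every block. -/
theorem exists_partial_coupling {Ω : Type*} [MeasurableSpace Ω] (P : Finset (Set Ω))
    (hm : ∀ A ∈ P, MeasurableSet A) (hd : (P : Set (Set Ω)).PairwiseDisjoint id)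
    (μ ν : Measure Ω) [IsFiniteMeasure μ] [IsFiniteMeasure ν] :
    ∃ τ : Measure (Ω × Ω), τ.map Prod.fst ≤ μ ∧ τ.map Prod.snd ≤ ν ∧
      (∀ᵐ z ∂τ, ∃ A ∈ P, z.1 ∈ A ∧ z.2 ∈ A) ∧
      ∀ A ∈ P, μ A ≤ τ.map Prod.fst A ∨ ν A ≤ τ.map Prod.snd A := by
  set c : Set Ω → ℝ≥0∞ := fun A => (max (μ A) (ν A))⁻¹ with hc
  have fst_eq : (∑ A ∈ P, c A • (μ.restrict A).prod (ν.restrict A)).map Prod.fst =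
      ∑ A ∈ P, (c A * ν A) • μ.restrict A := by
    rw [Measure.map_finset_sum measurable_fst.aemeasurable]
    refine Finset.sum_congr rfl fun A _ => ?_
    rw [Measure.map_smul, Measure.map_fst_prod, Measure.restrict_apply_univ, smul_smul]
  have snd_eq : (∑ A ∈ P, c A • (μ.restrict A).prod (ν.restrict A)).map Prod.snd =
      ∑ A ∈ P, (c A * μ A) • ν.restrict A := by
    rw [Measure.map_finset_sum measurable_snd.aemeasurable]
    refine Finset.sum_congr rfl fun A _ => ?_
    rw [Measure.map_smul, Measure.map_snd_prod, Measure.restrict_apply_univ, smul_smul]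
  have le_one : ∀ A, ∀ x ≤ max (μ A) (ν A), c A * x ≤ 1 := fun A x hx => by
    rw [hc, mul_comm, ← div_eq_mul_inv]
    exact ENNReal.div_le_of_le_mul (by simpa using hx)
  have sum_le : ∀ (d : Set Ω → ℝ≥0∞) (η : Measure Ω), (∀ A, d A ≤ 1) →
      ∑ A ∈ P, d A • η.restrict A ≤ η := fun d η h =>
    (Finset.sum_le_sum fun A _ => Measure.le_iff.2 fun s _ => by
      simpa using mul_le_mul_left (h A) (η.restrict A s)).trans (sum_restrict_le P hm hd η)
  have le_sum : ∀ (d : Set Ω → ℝ≥0∞) (η : Measure Ω), ∀ A ∈ P, (η A ≠ 0 → d A = 1) →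
      η A ≤ (∑ B ∈ P, d B • η.restrict B) A := fun d η A hA h => by
    rw [Measure.finsetSum_apply]
    refine le_trans ?_ (Finset.single_le_sum (fun _ _ => zero_le) hA)
    by_cases h0 : η A = 0
    · simp [h0]
    · simp [h h0]
  refine ⟨∑ A ∈ P, c A • (μ.restrict A).prod (ν.restrict A), ?_, ?_, ?_, fun A hA => ?_⟩
  · rw [fst_eq]
    exact sum_le _ _ fun A => le_one A _ (le_max_right _ _)
  · rw [snd_eq]
    exact sum_le _ _ fun A => le_one A _ (le_max_left _ _)
  · rw [ae_finsetSum_measure_iff]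
    intro A hA
    refine Measure.ae_smul_measure ?_ _
    rw [Measure.prod_restrict]
    filter_upwards [ae_restrict_mem ((hm A hA).prod (hm A hA))] with z hz
    exact ⟨A, hA, hz.1, hz.2⟩
  · rcases le_total (μ A) (ν A) with h | h
    · left
      rw [fst_eq]
      refine le_sum _ _ A hA fun h0 => ?_
      simp only [hc, max_eq_right h]
      exact ENNReal.inv_mul_cancel (fun h' => h0 (le_antisymm (h' ▸ h) zero_le))
        (measure_ne_top _ _)
    · right
      rw [snd_eq]
      refine le_sum _ _ A hA fun h0 => ?_
      simp only [hc, max_eq_left h]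
      exact ENNReal.inv_mul_cancel (fun h' => h0 (le_antisymm (h' ▸ h) zero_le))
        (measure_ne_top _ _)

/-- A partial coupling that only moves mass inside the blocks of a partition and exhausts one of
the two marginals on each block misses at most the total discrepancy over the blocks. -/
theorem one_sub_mass_le {Ω : Type*} [MeasurableSpace Ω] (P : Finset (Set Ω))
    (hm : ∀ A ∈ P, MeasurableSet A) (hd : (P : Set (Set Ω)).PairwiseDisjoint id)
    (hcov : ⋃₀ (P : Set (Set Ω)) = Set.univ)
    (μ ν : Measure Ω) [IsProbabilityMeasure μ] [IsProbabilityMeasure ν]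
    (π : Measure (Ω × Ω)) [IsFiniteMeasure π]
    (hblock : ∀ᵐ z ∂π, ∃ A ∈ P, z.1 ∈ A ∧ z.2 ∈ A)
    (hfull : ∀ A ∈ P, μ A ≤ π.map Prod.fst A ∨ ν A ≤ π.map Prod.snd A) :
    1 - π.real Set.univ ≤ ∑ A ∈ P, |(μ A).toReal - (ν A).toReal| := by
  have total : ∀ (η : Measure Ω) [IsFiniteMeasure η], η.real Set.univ = ∑ A ∈ P, η.real A := by
    intro η _
    rw [← hcov, Set.sUnion_eq_biUnion]
    exact measureReal_biUnion_finset hd hm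
  have hsymm : ∀ A ∈ P, π.map Prod.fst A = π.map Prod.snd A := by
    intro A hA
    rw [Measure.map_apply measurable_fst (hm A hA), Measure.map_apply measurable_snd (hm A hA)]
    refine measure_congr ?_
    filter_upwards [hblock] with z ⟨B, hB, h1, h2⟩
    refine propext ?_
    change z.1 ∈ A ↔ z.2 ∈ A
    by_cases hAB : A = B
    · subst hAB
      exact iff_of_true h1 h2
    · have := Set.disjoint_left.1 (hd hA hB hAB)
      exact iff_of_false (fun h => this h h1) fun h => this h h2
  have hmass : π.real Set.univ = (π.map Prod.fst).real Set.univ := by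
    rw [map_measureReal_apply measurable_fst MeasurableSet.univ, Set.preimage_univ]
  have hone : (1 : ℝ) = ∑ A ∈ P, μ.real A := by rw [← total μ, probReal_univ]
  rw [hmass, total, hone, ← Finset.sum_sub_distrib]
  refine Finset.sum_le_sum fun A hA => ?_
  change μ.real A - _ ≤ |μ.real A - ν.real A|
  rcases hfull A hA with h | h
  · have : μ.real A ≤ (π.map Prod.fst).real A := ENNReal.toReal_mono (measure_ne_top _ _) h
    linarith [abs_nonneg (μ.real A - ν.real A)]
  · rw [← hsymm A hA] at h
    have : ν.real A ≤ (π.map Prod.fst).real A := ENNReal.toReal_mono (measure_ne_top _ _) h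
    linarith [le_abs_self (μ.real A - ν.real A)]

theorem partitionRes_nonneg {Ω : Type*} [MetricSpace Ω] (P : Finset (Set Ω)) :
    0 ≤ partitionRes P :=
  Real.sSup_nonneg (by rintro _ ⟨A, _, rfl⟩; exact Metric.diam_nonneg)

theorem dist_le_partitionRes {Ω : Type*} [MetricSpace Ω]
    (hbdd : Bornology.IsBounded (Set.univ : Set Ω)) (P : Finset (Set Ω)) {A : Set Ω}
    (hA : A ∈ P) {x y : Ω} (hx : x ∈ A) (hy : y ∈ A) : dist x y ≤ partitionRes P :=
  (Metric.dist_le_diam_of_mem (hbdd.subset (Set.subset_univ A)) hx hy).trans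
    (le_csSup (P.finite_toSet.image _).bddAbove ⟨A, hA, rfl⟩)

/-- The cost of a measure that only moves mass inside the blocks of a finite partition. -/
theorem lintegral_dist_rpow_le {Ω : Type*} [MetricSpace Ω] [MeasurableSpace Ω]
    (hbdd : Bornology.IsBounded (Set.univ : Set Ω)) (P : Finset (Set Ω))
    {v : ℝ} (hv : 0 ≤ v) (τ : Measure (Ω × Ω)) [IsFiniteMeasure τ]
    (hblock : ∀ᵐ z ∂τ, ∃ A ∈ P, z.1 ∈ A ∧ z.2 ∈ A) {m : ℝ} (hmass : τ.real Set.univ ≤ m) :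
    ∫⁻ z, ENNReal.ofReal (dist z.1 z.2 ^ v) ∂τ ≤ ENNReal.ofReal (partitionRes P ^ v * m) := by
  have hR : 0 ≤ partitionRes P ^ v := Real.rpow_nonneg (partitionRes_nonneg P) v
  calc ∫⁻ z, ENNReal.ofReal (dist z.1 z.2 ^ v) ∂τ
      ≤ ∫⁻ _, ENNReal.ofReal (partitionRes P ^ v) ∂τ := by
        refine lintegral_mono_ae ?_
        filter_upwards [hblock] with z ⟨A, hA, h1, h2⟩
        exact ENNReal.ofReal_le_ofReal
          (Real.rpow_le_rpow dist_nonneg (dist_le_partitionRes hbdd P hA h1 h2) hv)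
    _ = ENNReal.ofReal (partitionRes P ^ v * τ.real Set.univ) := by
        rw [lintegral_const, ENNReal.ofReal_mul hR, ofReal_measureReal]
    _ ≤ ENNReal.ofReal (partitionRes P ^ v * m) :=
        ENNReal.ofReal_le_ofReal (mul_le_mul_of_nonneg_left hmass hR)

theorem measure_univ_le_one_of_map_fst_le {Ω : Type*} [MeasurableSpace Ω] {μ : Measure Ω}
    [IsProbabilityMeasure μ] {π : Measure (Ω × Ω)} (h : π.map Prod.fst ≤ μ) :
    π Set.univ ≤ 1 := by
  have := h Set.univ
  rwa [Measure.map_apply measurable_fst MeasurableSet.univ, Set.preimage_univ,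
    measure_univ (μ := μ)] at this

/-- Extend a partial coupling of `μ` and `ν` by moving mass inside the blocks of a partition,
so that one of the two marginals is exhausted on every block. -/
theorem exists_extend_partial_coupling {Ω : Type*} [MeasurableSpace Ω] (P : Finset (Set Ω))
    (hm : ∀ A ∈ P, MeasurableSet A) (hd : (P : Set (Set Ω)).PairwiseDisjoint id)
    (μ ν : Measure Ω) [IsFiniteMeasure μ] [IsFiniteMeasure ν]
    (π : Measure (Ω × Ω)) [IsFiniteMeasure π]
    (hfst : π.map Prod.fst ≤ μ) (hsnd : π.map Prod.snd ≤ ν) :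
    ∃ τ : Measure (Ω × Ω), (τ + π).map Prod.fst ≤ μ ∧ (τ + π).map Prod.snd ≤ ν ∧
      (∀ᵐ z ∂τ, ∃ A ∈ P, z.1 ∈ A ∧ z.2 ∈ A) ∧
      ∀ A ∈ P, μ A ≤ (τ + π).map Prod.fst A ∨ ν A ≤ (τ + π).map Prod.snd A := by
  have hμ := Measure.sub_add_cancel_of_le hfst
  have hν := Measure.sub_add_cancel_of_le hsnd
  obtain ⟨τ, h1, h2, h3, h4⟩ := exists_partial_coupling P hm hd
    (μ - π.map Prod.fst) (ν - π.map Prod.snd)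
  refine ⟨τ, ?_, ?_, h3, fun A hA => ?_⟩
  · rw [Measure.map_add _ _ measurable_fst]
    exact (add_le_add_left h1 _).trans_eq hμ
  · rw [Measure.map_add _ _ measurable_snd]
    exact (add_le_add_left h2 _).trans_eq hν
  · rw [Measure.map_add _ _ measurable_fst, Measure.map_add _ _ measurable_snd]
    refine (h4 A hA).imp (fun h => ?_) fun h => ?_
    · calc μ A = (μ - π.map Prod.fst + π.map Prod.fst) A := by rw [hμ]
        _ ≤ _ := by simpa only [Measure.add_apply] using add_le_add_left h _
    · calc ν A = (ν - π.map Prod.snd + π.map Prod.snd) A := by rw [hν]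
        _ ≤ _ := by simpa only [Measure.add_apply] using add_le_add_left h _

/-- The greedy partial coupling down to level `k`, with its cost. -/
theorem exists_greedy_coupling {Ω : Type*} [MetricSpace Ω] [MeasurableSpace Ω]
    (hbdd : Bornology.IsBounded (Set.univ : Set Ω)) (K : ℕ) (S : ℕ → Finset (Set Ω))
    (hmeas : ∀ k ≤ K, ∀ A ∈ S k, MeasurableSet A)
    (hcover : ∀ k ≤ K, ⋃₀ (S k : Set (Set Ω)) = Set.univ)
    (hdisj : ∀ k ≤ K, (S k : Set (Set Ω)).PairwiseDisjoint id)
    (hnested : ∀ k, 1 ≤ k → k ≤ K → ∀ T ∈ S k, ∃ A ∈ S (k - 1), T ⊆ A)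
    {v : ℝ} (hv : 0 ≤ v)
    (μ ν : Measure Ω) [IsProbabilityMeasure μ] [IsProbabilityMeasure ν] (j k : ℕ)
    (hjk : k + j = K) :
    ∃ π : Measure (Ω × Ω), π.map Prod.fst ≤ μ ∧ π.map Prod.snd ≤ ν ∧
      (∀ᵐ z ∂π, ∃ A ∈ S k, z.1 ∈ A ∧ z.2 ∈ A) ∧
      (∀ A ∈ S k, μ A ≤ π.map Prod.fst A ∨ ν A ≤ π.map Prod.snd A) ∧
      ∫⁻ z, ENNReal.ofReal (dist z.1 z.2 ^ v) ∂π ≤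
        ENNReal.ofReal (partitionRes (S K) ^ v + ∑ i ∈ Finset.Icc (k + 1) K,
          partitionRes (S (i - 1)) ^ v * ∑ A ∈ S i, |(μ A).toReal - (ν A).toReal|) := by
  have hR : ∀ i, 0 ≤ partitionRes (S i) ^ v :=
    fun i => Real.rpow_nonneg (partitionRes_nonneg (S i)) v
  have hterm : ∀ i, 0 ≤ partitionRes (S (i - 1)) ^ v *
      ∑ A ∈ S i, |(μ A).toReal - (ν A).toReal| :=
    fun i => mul_nonneg (hR _) (Finset.sum_nonneg fun _ _ => abs_nonneg _)
  induction j generalizing k with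
  | zero =>
    obtain rfl : k = K := by omega
    obtain ⟨τ, h1, h2, h3, h4⟩ :=
      exists_partial_coupling (S k) (hmeas k le_rfl) (hdisj k le_rfl) μ ν
    have hle := measure_univ_le_one_of_map_fst_le h1
    have : IsFiniteMeasure τ := ⟨hle.trans_lt ENNReal.one_lt_top⟩
    refine ⟨τ, h1, h2, h3, h4, ?_⟩
    simpa using lintegral_dist_rpow_le hbdd (S k) hv τ h3 (m := 1)
      (ENNReal.toReal_mono ENNReal.one_ne_top hle)
  | succ j ih =>
    obtain ⟨π, h1, h2, h3, h4, h5⟩ := ih (k + 1) (by omega)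
    have : IsFiniteMeasure π :=
      ⟨(measure_univ_le_one_of_map_fst_le h1).trans_lt ENNReal.one_lt_top⟩
    have hkK : k + 1 ≤ K := by omega
    obtain ⟨τ, t1, t2, t3, t4⟩ := exists_extend_partial_coupling (S k)
      (hmeas k (by omega)) (hdisj k (by omega)) μ ν π h1 h2
    have hle := measure_univ_le_one_of_map_fst_le t1
    have : IsFiniteMeasure τ :=
      ⟨((Measure.le_add_right le_rfl : τ ≤ τ + π) _).trans_lt
        (hle.trans_lt ENNReal.one_lt_top)⟩
    have hmass : τ.real Set.univ ≤ ∑ A ∈ S (k + 1), |(μ A).toReal - (ν A).toReal| := by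
      have h := one_sub_mass_le (S (k + 1)) (hmeas _ hkK) (hdisj _ hkK) (hcover _ hkK) μ ν π h3 h4
      have h' : (τ + π).real Set.univ ≤ 1 := ENNReal.toReal_mono ENNReal.one_ne_top hle
      rw [measureReal_add_apply] at h'
      linarith
    refine ⟨τ + π, t1, t2, ?_, t4, ?_⟩
    · rw [ae_add_measure_iff]
      refine ⟨t3, ?_⟩
      filter_upwards [h3] with z ⟨A, hA, hz1, hz2⟩
      obtain ⟨B, hB, hAB⟩ := hnested (k + 1) (by omega) hkK A hA
      exact ⟨B, hB, hAB hz1, hAB hz2⟩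
    · rw [lintegral_add_measure]
      refine (add_le_add (lintegral_dist_rpow_le hbdd (S k) hv τ t3 hmass) h5).trans_eq ?_
      have hterm' := hterm (k + 1)
      rw [Nat.add_sub_cancel] at hterm'
      rw [← ENNReal.ofReal_add hterm'
        (add_nonneg (hR K) (Finset.sum_nonneg fun i _ => hterm i)),
        ← Finset.add_sum_Ioc_eq_sum_Icc hkK, ← Finset.Icc_add_one_left_eq_Ioc]
      congr 1
      simp only [Nat.add_sub_cancel]
      ring

theorem wassersteinMetric_rpow_le {Ω : Type*} [MetricSpace Ω] [MeasurableSpace Ω] {v : ℝ}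
    (hv : v ≠ 0) {μ ν : Measure Ω} (π : Measure (Ω × Ω)) [IsProbabilityMeasure π]
    (hfst : π.map Prod.fst = μ) (hsnd : π.map Prod.snd = ν) :
    wassersteinMetric v μ ν ^ v ≤ ∫ z, dist z.1 z.2 ^ v ∂π := by
  have hpos : ∀ r ∈ { r : ℝ | ∃ π : Measure (Ω × Ω),
      IsProbabilityMeasure π ∧ π.map Prod.fst = μ ∧ π.map Prod.snd = ν ∧
      r = ∫ z, dist z.1 z.2 ^ v ∂π }, 0 ≤ r := by
    rintro _ ⟨π, _, _, _, rfl⟩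
    exact integral_nonneg fun z => Real.rpow_nonneg dist_nonneg v
  rw [wassersteinMetric, ← Real.rpow_mul (Real.sInf_nonneg hpos), one_div_mul_cancel hv,
    Real.rpow_one]
  exact csInf_le ⟨0, hpos⟩ ⟨π, inferInstance, hfst, hsnd, rfl⟩

theorem integral_le_of_lintegral_ofReal_le {α : Type*} [MeasurableSpace α] {π : Measure α}
    {f : α → ℝ} (hf : ∀ x, 0 ≤ f x) {C : ℝ} (hC : 0 ≤ C)
    (h : ∫⁻ x, ENNReal.ofReal (f x) ∂π ≤ ENNReal.ofReal C) : ∫ x, f x ∂π ≤ C := by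
  by_cases hint : Integrable f π
  · rw [← ENNReal.ofReal_le_ofReal_iff hC,
      ofReal_integral_eq_lintegral_ofReal hint (Eventually.of_forall hf)]
    exact h
  · rwa [integral_undef hint]

/-- multiresolution upper bound for the Wasserstein distance. -/
theorem wasserstein_multiresolution_bound
    {Ω : Type*} [MetricSpace Ω] [MeasurableSpace Ω] [BorelSpace Ω]
    (hbdd : Bornology.IsBounded (Set.univ : Set Ω))
    (K : ℕ) (hK : 1 ≤ K) (S : ℕ → Finset (Set Ω))
    (hS0 : S 0 = {Set.univ})
    (hmeas : ∀ k ≤ K, ∀ A ∈ S k, MeasurableSet A)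
    (hcover : ∀ k ≤ K, ⋃₀ (S k : Set (Set Ω)) = Set.univ)
    (hdisj : ∀ k ≤ K, ∀ A ∈ S k, ∀ B ∈ S k, A ≠ B → A ∩ B = ∅)
    (hnested : ∀ k, 1 ≤ k → k ≤ K → ∀ T ∈ S k, ∃ A ∈ S (k - 1), T ⊆ A)
    (v : ℝ) (hv : 1 ≤ v)
    (μ ν : Measure Ω) [IsProbabilityMeasure μ] [IsProbabilityMeasure ν] :
    wassersteinMetric v μ ν ^ v ≤
      partitionRes (S K) ^ v +
        ∑ k ∈ Finset.Icc 1 K,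
          partitionRes (S (k - 1)) ^ v * ∑ A ∈ S k, |(μ A).toReal - (ν A).toReal| := by
  have hv0 : 0 < v := by linarith
  obtain ⟨π, h1, h2, -, h4, h5⟩ := exists_greedy_coupling hbdd K S hmeas hcover
    (fun k hk A hA B hB hAB => Set.disjoint_iff_inter_eq_empty.2 (hdisj k hk A hA B hB hAB))
    hnested hv0.le μ ν K 0 (by omega)
  have hπ : π Set.univ = 1 := by
    refine le_antisymm (measure_univ_le_one_of_map_fst_le h1) ?_
    simpa [Measure.map_apply measurable_fst MeasurableSet.univ,
      Measure.map_apply measurable_snd MeasurableSet.univ] using h4 Set.univ (by simp [hS0])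
  have : IsProbabilityMeasure π := ⟨hπ⟩
  have := Measure.isProbabilityMeasure_map (μ := π) measurable_fst.aemeasurable
  have := Measure.isProbabilityMeasure_map (μ := π) measurable_snd.aemeasurable
  refine (wassersteinMetric_rpow_le hv0.ne' π (Measure.eq_of_le_of_isProbabilityMeasure h1)
    (Measure.eq_of_le_of_isProbabilityMeasure h2)).trans ?_
  refine integral_le_of_lintegral_ofReal_le (fun z => Real.rpow_nonneg dist_nonneg v) ?_ h5
  have hR : ∀ i, 0 ≤ partitionRes (S i) ^ v :=
    fun i => Real.rpow_nonneg (partitionRes_nonneg (S i)) v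
  exact add_nonneg (hR K) (Finset.sum_nonneg fun i _ =>
    mul_nonneg (hR _) (Finset.sum_nonneg fun _ _ => abs_nonneg _))

end
end

section
/- Let (E, 𝔈) be a measurable space, μ a probability measure on E, and A₁,…,A_k measurable sets forming a partition of E, with p_j = μ(A_j). Let Y₁,…,Y_n be i.i.d. random variables with law μ, and set X_j = Σ_{i=1}^{n} 1(Y_i ∈ A_j), so that (X₁,…,X_k) has the Multinomial(n, p₁,…,p_k) distribution. Then E[ Σ_{j=1}^{k} |X_j − n·p_j| ] ≤ n·√((k−1)/n). -/
open MeasureTheory Filter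
open scoped ENNReal NNReal Classical BigOperators

noncomputable section

section Counts

variable {E : Type*} [MeasurableSpace E]

theorem card_filter_mem_eq_sum_indicator {E : Type*} (n : ℕ) (A : Set E) :
    (fun Y : Fin n → E => ((Finset.univ.filter fun i => Y i ∈ A).card : ℝ)) =
      ∑ i : Fin n, fun Y : Fin n → E => A.indicator (fun _ => (1 : ℝ)) (Y i) := by
  ext Y
  simp [Set.indicator_apply]

theorem memLp_count (μ : Measure E) [IsProbabilityMeasure μ] (n : ℕ) {A : Set E}
    (hA : MeasurableSet A) :
    MemLp (fun Y : Fin n → E => ((Finset.univ.filter fun i => Y i ∈ A).card : ℝ)) 2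
      (Measure.pi fun _ => μ) := by
  rw [card_filter_mem_eq_sum_indicator]
  refine memLp_finsetSum' _ fun i _ => ?_
  exact (memLp_indicator_const 2 hA (1 : ℝ) (.inr (measure_ne_top μ A))).comp_measurePreserving
    (measurePreserving_eval (fun _ : Fin n => μ) i)

theorem integral_count (μ : Measure E) [IsProbabilityMeasure μ] (n : ℕ) {A : Set E}
    (hA : MeasurableSet A) :
    ∫ Y : Fin n → E, ((Finset.univ.filter fun i => Y i ∈ A).card : ℝ) ∂(Measure.pi fun _ => μ) =
      n * μ.real A := by
  have hint := memLp_indicator_const (μ := μ) 1 hA (1 : ℝ) (.inr (measure_ne_top μ A))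
  rw [card_filter_mem_eq_sum_indicator]
  rw [Finset.sum_fn]
  rw [integral_finsetSum (f := fun i (Y : Fin n → E) => A.indicator (fun _ => (1 : ℝ)) (Y i)) _
    fun i _ => memLp_one_iff_integrable.1
    (hint.comp_measurePreserving (measurePreserving_eval (fun _ : Fin n => μ) i))]
  simp_rw [integral_comp_eval (μ := fun _ : Fin n => μ) hint.aestronglyMeasurable]
  simp [integral_indicator_const _ hA]

theorem variance_indicator_one (μ : Measure E) [IsProbabilityMeasure μ] {A : Set E}
    (hA : MeasurableSet A) :
    ProbabilityTheory.variance (A.indicator fun _ => (1 : ℝ)) μ = μ.real A - μ.real A ^ 2 := by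
  rw [ProbabilityTheory.variance_eq_sub
    (memLp_indicator_const 2 hA (1 : ℝ) (.inr (measure_ne_top μ A)))]
  have hsq : (A.indicator fun _ => (1 : ℝ)) ^ 2 = A.indicator fun _ => (1 : ℝ) := by
    ext x
    by_cases hx : x ∈ A <;> simp [hx]
  rw [hsq, integral_indicator_const _ hA]
  simp

theorem integral_sq_count_sub (μ : Measure E) [IsProbabilityMeasure μ] (n : ℕ) {A : Set E}
    (hA : MeasurableSet A) :
    ∫ Y : Fin n → E, (((Finset.univ.filter fun i => Y i ∈ A).card : ℝ) - n * μ.real A) ^ 2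
      ∂(Measure.pi fun _ => μ) = n * (μ.real A - μ.real A ^ 2) := by
  have hvar := ProbabilityTheory.variance_eq_integral (memLp_count μ n hA).aemeasurable
  rw [integral_count μ n hA] at hvar
  rw [← hvar, card_filter_mem_eq_sum_indicator, ProbabilityTheory.variance_sum_pi
    (μ := fun _ : Fin n => μ) (X := fun _ => A.indicator fun _ => (1 : ℝ))
    fun _ => memLp_indicator_const 2 hA (1 : ℝ) (.inr (measure_ne_top μ A))]
  simp [variance_indicator_one μ hA, mul_sub]

end Counts

theorem sq_integral_le_integral_sq {Ω : Type*} [MeasurableSpace Ω] {P : Measure Ω}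
    [IsProbabilityMeasure P] {f : Ω → ℝ} (hf : MemLp f 2 P) :
    (∫ x, f x ∂P) ^ 2 ≤ ∫ x, f x ^ 2 ∂P := by
  have h := ProbabilityTheory.variance_nonneg f P
  rw [ProbabilityTheory.variance_eq_sub hf] at h
  simpa using h

/-- multinomial concentration. If (X₁,…,X_k) are the counts of an i.i.d. sample of
size n in a measurable partition A₁,…,A_k with cell probabilities p_j = μ(A_j), then
E[Σ_j |X_j − n p_j|] ≤ n √((k−1)/n). -/
theorem multinomial_concentration
    {E : Type*} [MeasurableSpace E] (μ : Measure E) [IsProbabilityMeasure μ]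
    (k n : ℕ) (A : Fin k → Set E)
    (hmeas : ∀ j, MeasurableSet (A j))
    (hdisj : ∀ i j, i ≠ j → A i ∩ A j = ∅)
    (hcover : (⋃ j, A j) = Set.univ) :
    ∫ Y : Fin n → E,
        ∑ j, |(((Finset.univ.filter fun i => Y i ∈ A j).card : ℝ)) - n * (μ (A j)).toReal|
      ∂(Measure.pi fun _ : Fin n => μ)
      ≤ n * Real.sqrt (((k : ℝ) - 1) / n) := by
  set p : Fin k → ℝ := fun j => μ.real (A j) with hp
  have hsum : ∑ j, p j = 1 := by
    rw [← measureReal_iUnion_fintype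
      (fun i j hij => Set.disjoint_iff_inter_eq_empty.2 (hdisj i j hij)) hmeas, hcover]
    simp
  have hD (j : Fin k) : MemLp (fun Y : Fin n → E =>
      ((Finset.univ.filter fun i => Y i ∈ A j).card : ℝ) - n * p j) 2
      (Measure.pi fun _ => μ) := (memLp_count μ n (hmeas j)).sub (memLp_const _)
  have hS : MemLp (fun Y : Fin n → E =>
      ∑ j, |((Finset.univ.filter fun i => Y i ∈ A j).card : ℝ) - n * p j|) 2
      (Measure.pi fun _ => μ) := memLp_finsetSum _ fun j _ => (hD j).abs
  have hsecond : ∫ Y : Fin n → E,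
      (∑ j, |((Finset.univ.filter fun i => Y i ∈ A j).card : ℝ) - n * p j|) ^ 2
      ∂(Measure.pi fun _ => μ) ≤ k * ∑ j, n * (p j - p j ^ 2) := by
    calc
      _ ≤ ∫ Y : Fin n → E,
          k * ∑ j, (((Finset.univ.filter fun i => Y i ∈ A j).card : ℝ) - n * p j) ^ 2
          ∂(Measure.pi fun _ => μ) := by
        refine integral_mono hS.integrable_sq
          ((integrable_finsetSum _ fun j _ => (hD j).integrable_sq).const_mul _) fun Y => ?_
        simpa using sq_sum_le_card_mul_sum_sq (s := Finset.univ)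
          (f := fun j => |((Finset.univ.filter fun i => Y i ∈ A j).card : ℝ) - n * p j|)
      _ = _ := by
        rw [integral_const_mul, integral_finsetSum _ fun j _ => (hD j).integrable_sq]
        simp_rw [hp, integral_sq_count_sub μ n (hmeas _)]
  have hcs : 1 ≤ k * ∑ j, p j ^ 2 := by
    simpa [hsum] using sq_sum_le_card_mul_sum_sq (s := Finset.univ) (f := p)
  have hbound : (k : ℝ) * ∑ j, n * (p j - p j ^ 2) ≤ n * (k - 1) := by
    rw [← Finset.mul_sum, Finset.sum_sub_distrib, hsum]
    nlinarith [mul_le_mul_of_nonneg_left hcs (Nat.cast_nonneg (α := ℝ) n)]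
  have hrhs : n * Real.sqrt (((k : ℝ) - 1) / n) = Real.sqrt (n * (k - 1)) := by
    rcases Nat.eq_zero_or_pos n with rfl | hn
    · simp
    · have hn' : (0 : ℝ) < n := Nat.cast_pos.2 hn
      rw [show (n : ℝ) * (k - 1) = n ^ 2 * ((k - 1) / n) by field_simp,
        Real.sqrt_mul (sq_nonneg _), Real.sqrt_sq hn'.le]
  rw [hrhs]
  exact Real.le_sqrt_of_sq_le ((sq_integral_le_integral_sq hS).trans (hsecond.trans hbound))

end
end

section
/- Let k ∈ ℕ, let α₁,…,α_k > 0, and set ᾱ = Σ_{j=1}^{k} α_j. Let (π₁,…,π_k) have the Dirichlet(α₁,…,α_k) distribution. Then E[ Σ_{j=1}^{k} |π_j − α_j/ᾱ| ] ≤ ᾱ^{−1/2}·√k. -/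
open MeasureTheory Filter
open scoped ENNReal NNReal Classical BigOperators

noncomputable section

open ProbabilityTheory

theorem ae_pos_gammaMeasure (a r : ℝ) : ∀ᵐ x ∂gammaMeasure a r, 0 < x := by
  rw [gammaMeasure, ae_withDensity_iff (by unfold gammaPDF; fun_prop)]
  filter_upwards [Measure.ae_ne volume (0 : ℝ)] with x hx h
  by_contra hneg
  exact h (gammaPDF_of_neg (lt_of_le_of_ne (not_lt.mp hneg) hx))

theorem lintegral_rpow_mul_exp_gammaMeasure {a s t : ℝ} (ha : 0 < a) (hs : 0 ≤ s) (ht : -1 < t) :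
    ∫⁻ x, ENNReal.ofReal (x ^ s * Real.exp (-(t * x))) ∂gammaMeasure a 1 =
      ENNReal.ofReal (Real.Gamma (a + s) / Real.Gamma a * (1 + t) ^ (-(a + s))) := by
  have hmeas (a r : ℝ) : Measurable (gammaPDF a r) := by unfold gammaPDF; fun_prop
  have ht' : 0 < 1 + t := by linarith
  rw [gammaMeasure, lintegral_withDensity_eq_lintegral_mul _ (hmeas a 1) (by fun_prop)]
  have key : ∀ᵐ x : ℝ, (gammaPDF a 1 * fun x => ENNReal.ofReal (x ^ s * Real.exp (-(t * x)))) x =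
      ENNReal.ofReal (Real.Gamma (a + s) / Real.Gamma a * (1 + t) ^ (-(a + s))) *
        gammaPDF (a + s) (1 + t) x := by
    filter_upwards [Measure.ae_ne volume (0 : ℝ)] with x hx
    rcases lt_or_gt_of_ne hx with hx | hx
    · simp [gammaPDF_of_neg hx]
    · have h1 := Real.Gamma_pos_of_pos ha
      have h2 := Real.Gamma_pos_of_pos (show 0 < a + s by linarith)
      rw [Pi.mul_apply, gammaPDF_of_nonneg hx.le, gammaPDF_of_nonneg hx.le,
        ← ENNReal.ofReal_mul (by positivity), ← ENNReal.ofReal_mul (by positivity)]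
      congr 1
      have hexp : Real.exp (-((1 + t) * x)) = Real.exp (-(1 * x)) * Real.exp (-(t * x)) := by
        rw [← Real.exp_add]; ring_nf
      have hpow : x ^ (a + s - 1) = x ^ (a - 1) * x ^ s := by
        rw [← Real.rpow_add hx]; ring_nf
      rw [hexp, hpow, Real.rpow_neg ht'.le, Real.one_rpow]
      field_simp
  rw [lintegral_congr_ae key, lintegral_const_mul _ (hmeas _ _),
    lintegral_gammaPDF_eq_one (by linarith) ht', mul_one]

theorem lintegral_pi_prod_eval {ι : Type*} [Fintype ι] (μ : ι → Measure ℝ)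
    [∀ i, IsProbabilityMeasure (μ i)] {f : ι → ℝ → ℝ≥0∞} (hf : ∀ i, Measurable (f i)) :
    ∫⁻ x, ∏ i, f i (x i) ∂Measure.pi μ = ∏ i, ∫⁻ x, f i x ∂μ i := by
  have h := lintegral_prod_eq_prod_lintegral_of_indepFun Finset.univ
    (fun i (x : ι → ℝ) => f i (x i)) (iIndepFun_pi (μ := μ) fun i => (hf i).aemeasurable)
    (fun i => (hf i).comp (measurable_pi_apply i))
  rw [h]
  refine Finset.prod_congr rfl fun i _ => ?_
  exact (measurePreserving_eval μ i).lintegral_comp (hf i)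

theorem ae_forall_pos_pi_gammaMeasure {ι : Type*} [Fintype ι] {β : ι → ℝ} (hβ : ∀ i, 0 < β i) :
    ∀ᵐ g ∂Measure.pi fun i => gammaMeasure (β i) 1, ∀ i, 0 < g i := by
  have (i : ι) := isProbabilityMeasure_gammaMeasure (hβ i) one_pos
  rw [ae_all_iff]
  exact fun i => Measure.tendsto_eval_ae_ae.eventually (ae_pos_gammaMeasure (β i) 1)

theorem lintegral_div_sum_rpow_eq_mul {ι : Type*} [Fintype ι] {β : ι → ℝ} (hβ : ∀ i, 0 < β i)
    (j : ι) {s : ℝ} (hs : 0 < s) :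
    ∫⁻ g, ENNReal.ofReal ((g j / ∑ i, g i) ^ s) ∂Measure.pi (fun i => gammaMeasure (β i) 1) =
      ENNReal.ofReal (Real.Gamma (β j + s) / Real.Gamma (β j)) *
        ∫⁻ t, ENNReal.ofReal (Real.exp t * (1 + t) ^ (-(∑ i, β i + s))) ∂gammaMeasure s 1 := by
  have (i : ι) := isProbabilityMeasure_gammaMeasure (hβ i) one_pos
  have := isProbabilityMeasure_gammaMeasure hs one_pos
  let c : ι → ℝ := fun i => if i = j then s else 0
  have hc (i : ι) : 0 ≤ c i := by dsimp [c]; split_ifs <;> linarith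
  let F : (ι → ℝ) → ℝ → ℝ≥0∞ := fun g t =>
    ENNReal.ofReal (Real.exp t) * ∏ i, ENNReal.ofReal (g i ^ c i * Real.exp (-(t * g i)))
  have hF : ∀ᵐ g ∂Measure.pi (fun i => gammaMeasure (β i) 1),
      ENNReal.ofReal ((g j / ∑ i, g i) ^ s) = ∫⁻ t, F g t ∂gammaMeasure s 1 := by
    filter_upwards [ae_forall_pos_pi_gammaMeasure hβ] with g hg
    have hS : 0 < ∑ i, g i := Finset.sum_pos (fun i _ => hg i) ⟨j, Finset.mem_univ j⟩
    have hlap := lintegral_rpow_mul_exp_gammaMeasure (s := 0) (t := ∑ i, g i - 1) hs le_rfl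
      (by linarith)
    have hgs : 0 ≤ g j ^ s := Real.rpow_nonneg (hg j).le s
    have hFg (t : ℝ) : F g t = ENNReal.ofReal (g j ^ s) *
        ENNReal.ofReal (t ^ (0 : ℝ) * Real.exp (-((∑ i, g i - 1) * t))) := by
      dsimp only [F]
      rw [← ENNReal.ofReal_prod_of_nonneg
        (fun i _ => mul_nonneg (Real.rpow_nonneg (hg i).le _) (Real.exp_nonneg _)),
        ← ENNReal.ofReal_mul (Real.exp_nonneg _), ← ENNReal.ofReal_mul hgs,
        Finset.prod_mul_distrib, ← Real.exp_sum, Finset.sum_neg_distrib, ← Finset.mul_sum]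
      have hprod : ∏ i, g i ^ c i = g j ^ s := by
        rw [Finset.prod_eq_single j] <;> simp +contextual [c]
      rw [hprod, Real.rpow_zero, one_mul, mul_left_comm, ← Real.exp_add]
      ring_nf
    simp_rw [hFg]
    rw [lintegral_const_mul _ (by fun_prop), hlap, ← ENNReal.ofReal_mul hgs]
    congr 1
    rw [add_zero, div_self (Real.Gamma_pos_of_pos hs).ne', one_mul, add_sub_cancel,
      Real.div_rpow (hg j).le hS.le, Real.rpow_neg hS.le, div_eq_mul_inv]
  rw [lintegral_congr_ae hF, lintegral_lintegral_swap (by unfold Function.uncurry; fun_prop),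
    ← lintegral_const_mul _ (by fun_prop)]
  refine lintegral_congr_ae ?_
  filter_upwards [ae_pos_gammaMeasure s 1] with t ht
  have hΓ (i : ι) : 0 ≤ Real.Gamma (β i + c i) / Real.Gamma (β i) :=
    div_nonneg (Real.Gamma_nonneg_of_nonneg (add_nonneg (hβ i).le (hc i)))
      (Real.Gamma_nonneg_of_nonneg (hβ i).le)
  have ht1 : 0 < 1 + t := by linarith
  have hprod : ∏ i, Real.Gamma (β i + c i) / Real.Gamma (β i) =
      Real.Gamma (β j + s) / Real.Gamma (β j) := by
    rw [Finset.prod_eq_single j]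
    · simp [c]
    · intro i _ hij
      simp [c, hij, (Real.Gamma_pos_of_pos (hβ i)).ne']
    · simp
  have hsum : ∑ i, (β i + c i) = ∑ i, β i + s := by
    rw [Finset.sum_add_distrib]; simp [c]
  dsimp only [F]
  rw [lintegral_const_mul _ (by fun_prop), lintegral_pi_prod_eval (fun i => gammaMeasure (β i) 1)
    (f := fun i x => ENNReal.ofReal (x ^ c i * Real.exp (-(t * x)))) (fun i => by fun_prop)]
  simp_rw [fun i => lintegral_rpow_mul_exp_gammaMeasure (hβ i) (hc i) (show -1 < t by linarith)]
  rw [← ENNReal.ofReal_prod_of_nonneg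
      (fun i _ => mul_nonneg (hΓ i) (Real.rpow_nonneg ht1.le _)),
    Finset.prod_mul_distrib, hprod, ← Real.rpow_sum_of_pos ht1, Finset.sum_neg_distrib, hsum,
    ← ENNReal.ofReal_mul (Real.exp_nonneg _),
    ← ENNReal.ofReal_mul (hprod ▸ Finset.prod_nonneg fun i _ => hΓ i)]
  congr 1
  ring

/-- Moments of the coordinates of the Dirichlet distribution. -/
theorem lintegral_div_sum_rpow {ι : Type*} [Fintype ι] {β : ι → ℝ} (hβ : ∀ i, 0 < β i)
    (j : ι) {s : ℝ} (hs : 0 < s) :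
    ∫⁻ g, ENNReal.ofReal ((g j / ∑ i, g i) ^ s) ∂Measure.pi (fun i => gammaMeasure (β i) 1) =
      ENNReal.ofReal (Real.Gamma (β j + s) / Real.Gamma (β j) *
        (Real.Gamma (∑ i, β i) / Real.Gamma (∑ i, β i + s))) := by
  have hA : 0 < ∑ i, β i := Finset.sum_pos (fun i _ => hβ i) ⟨j, Finset.mem_univ j⟩
  have h1 := Real.Gamma_pos_of_pos hA
  have h2 := Real.Gamma_pos_of_pos (add_pos hA hs)
  have h3 := Real.Gamma_pos_of_pos (hβ j)
  have h4 := Real.Gamma_pos_of_pos (add_pos (hβ j) hs)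
  have hunit := lintegral_div_sum_rpow_eq_mul (ι := Unit) (β := fun _ => ∑ i, β i)
    (fun _ => hA) () hs
  have hone : ∫⁻ g, ENNReal.ofReal ((g () / ∑ i, g i) ^ s)
      ∂Measure.pi (fun _ : Unit => gammaMeasure (∑ i, β i) 1) = 1 := by
    have := isProbabilityMeasure_gammaMeasure hA one_pos
    rw [lintegral_congr_ae (g := fun _ => 1), lintegral_one, measure_univ]
    filter_upwards [ae_forall_pos_pi_gammaMeasure (ι := Unit) (fun _ => hA)] with g hg
    simp [div_self (hg ()).ne']
  rw [hone, Fintype.sum_unique fun _ : Unit => ∑ i, β i] at hunit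
  rw [lintegral_div_sum_rpow_eq_mul hβ j hs, ENNReal.ofReal_mul (by positivity),
    ← inv_div (Real.Gamma (∑ i, β i + s)), ENNReal.ofReal_inv_of_pos (by positivity)]
  congr 1
  exact ENNReal.eq_inv_of_mul_eq_one_left (by rw [mul_comm]; exact hunit.symm)

theorem integral_div_sum_pow {ι : Type*} [Fintype ι] {β : ι → ℝ} (hβ : ∀ i, 0 < β i)
    (j : ι) {n : ℕ} (hn : n ≠ 0) :
    ∫ g, (g j / ∑ i, g i) ^ n ∂Measure.pi (fun i => gammaMeasure (β i) 1) =
      Real.Gamma (β j + n) / Real.Gamma (β j) *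
        (Real.Gamma (∑ i, β i) / Real.Gamma (∑ i, β i + n)) := by
  have hA : 0 < ∑ i, β i := Finset.sum_pos (fun i _ => hβ i) ⟨j, Finset.mem_univ j⟩
  have hn' : (0 : ℝ) < n := by positivity
  have h1 := Real.Gamma_pos_of_pos hA
  have h2 := Real.Gamma_pos_of_pos (add_pos hA hn')
  have h3 := Real.Gamma_pos_of_pos (hβ j)
  have h4 := Real.Gamma_pos_of_pos (add_pos (hβ j) hn')
  have h := lintegral_div_sum_rpow hβ j hn'
  simp_rw [Real.rpow_natCast] at h
  rw [integral_eq_lintegral_of_nonneg_ae, h, ENNReal.toReal_ofReal (by positivity)]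
  · filter_upwards [ae_forall_pos_pi_gammaMeasure hβ] with g hg
    exact pow_nonneg (div_nonneg (hg j).le (Finset.sum_nonneg fun i _ => (hg i).le)) n
  · exact Measurable.aestronglyMeasurable (by fun_prop)

theorem integrable_div_sum_pow {ι : Type*} [Fintype ι] {β : ι → ℝ} (hβ : ∀ i, 0 < β i)
    (j : ι) (n : ℕ) :
    Integrable (fun g : ι → ℝ => (g j / ∑ i, g i) ^ n)
      (Measure.pi fun i => gammaMeasure (β i) 1) := by
  have (i : ι) := isProbabilityMeasure_gammaMeasure (hβ i) one_pos
  refine Integrable.of_bound (Measurable.aestronglyMeasurable (by fun_prop)) 1 ?_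
  filter_upwards [ae_forall_pos_pi_gammaMeasure hβ] with g hg
  have hle : g j ≤ ∑ i, g i :=
    Finset.single_le_sum (f := g) (fun i _ => (hg i).le) (Finset.mem_univ j)
  have hnn : 0 ≤ g j / ∑ i, g i := div_nonneg (hg j).le ((hg j).le.trans hle)
  rw [Real.norm_of_nonneg (pow_nonneg hnn n)]
  exact pow_le_one₀ hnn (div_le_one_of_le₀ hle ((hg j).le.trans hle))

theorem integrable_sq_div_sum_sub {ι : Type*} [Fintype ι] {β : ι → ℝ} (hβ : ∀ i, 0 < β i)
    (j : ι) (p : ℝ) :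
    Integrable (fun g : ι → ℝ => (g j / ∑ i, g i - p) ^ 2)
      (Measure.pi fun i => gammaMeasure (β i) 1) := by
  have (i : ι) := isProbabilityMeasure_gammaMeasure (hβ i) one_pos
  have h1 := integrable_div_sum_pow hβ j 1
  simp only [pow_one] at h1
  refine (((integrable_div_sum_pow hβ j 2).sub (h1.const_mul (2 * p))).add
    (integrable_const (p ^ 2))).congr (ae_of_all _ fun g => ?_)
  simp only [Pi.add_apply, Pi.sub_apply]
  ring

/-- The variance of a coordinate of the Dirichlet distribution. -/
theorem integral_sq_div_sum_sub_mean {ι : Type*} [Fintype ι] {β : ι → ℝ} (hβ : ∀ i, 0 < β i)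
    (j : ι) :
    ∫ g, (g j / ∑ i, g i - β j / ∑ i, β i) ^ 2 ∂Measure.pi (fun i => gammaMeasure (β i) 1) =
      β j * (∑ i, β i - β j) / ((∑ i, β i) ^ 2 * (∑ i, β i + 1)) := by
  have (i : ι) := isProbabilityMeasure_gammaMeasure (hβ i) one_pos
  have hA : 0 < ∑ i, β i := Finset.sum_pos (fun i _ => hβ i) ⟨j, Finset.mem_univ j⟩
  have h1 := integrable_div_sum_pow hβ j 1
  have h2 := integrable_div_sum_pow hβ j 2
  have e1 := integral_div_sum_pow hβ j one_ne_zero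
  have e2 := integral_div_sum_pow hβ j two_ne_zero
  simp only [pow_one] at h1 e1
  have hΓ {a : ℝ} (ha : 0 < a) : Real.Gamma (a + 2) = (a + 1) * (a * Real.Gamma a) := by
    rw [← Real.Gamma_add_one ha.ne', ← Real.Gamma_add_one (by positivity)]
    ring_nf
  simp only [Nat.cast_one, Nat.cast_ofNat, Real.Gamma_add_one hA.ne',
    Real.Gamma_add_one (hβ j).ne', hΓ hA, hΓ (hβ j)] at e1 e2
  have hAΓ := Real.Gamma_pos_of_pos hA
  have hβΓ := Real.Gamma_pos_of_pos (hβ j)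
  set p := β j / ∑ i, β i with hp
  have hexpand (g : ι → ℝ) : (g j / ∑ i, g i - p) ^ 2 =
      (g j / ∑ i, g i) ^ 2 - 2 * p * (g j / ∑ i, g i) + p ^ 2 := by ring
  have h21 : Integrable (fun g : ι → ℝ => (g j / ∑ i, g i) ^ 2 - 2 * p * (g j / ∑ i, g i))
      (Measure.pi fun i => gammaMeasure (β i) 1) := h2.sub (h1.const_mul _)
  simp_rw [hexpand]
  rw [integral_add h21 (integrable_const _),
    integral_sub h2 (h1.const_mul _), integral_const_mul, e1, e2, integral_const, probReal_univ,
    one_smul, hp]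
  field_simp
  ring

/-- Dirichlet ℓ¹ mean deviation bound: E[Σ_j |π_j − α_j/ᾱ|] ≤ ᾱ^{−1/2}√k. -/
theorem dirichlet_l1_mean_deviation
    (k : ℕ) (α : Fin k → ℝ) (hα : ∀ j, 0 < α j) :
    ∫ x, (∑ j, |x j - α j / ∑ i, α i|) ∂(dirichlet α)
      ≤ (∑ j, α j) ^ (-(1 / 2) : ℝ) * Real.sqrt k := by
  rcases Nat.eq_zero_or_pos k with rfl | hk
  · simp
  have (i : Fin k) := isProbabilityMeasure_gammaMeasure (hα i) one_pos
  have hA : 0 < ∑ i, α i := Finset.sum_pos (fun i _ => hα i) ⟨⟨0, hk⟩, Finset.mem_univ _⟩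
  have hk' : (0 : ℝ) < k := by exact_mod_cast hk
  rw [dirichlet, integral_map (Measurable.aemeasurable (by fun_prop))
    (Measurable.aestronglyMeasurable (by fun_prop))]
  set A := ∑ i, α i with hAdef
  set c := Real.sqrt k * Real.sqrt A with hc
  have hcpos : 0 < c := by positivity
  have hint (j : Fin k) := integrable_sq_div_sum_sub hα j (α j / A)
  have hint' : Integrable (fun g : Fin k → ℝ => ∑ j, (g j / ∑ i, g i - α j / A) ^ 2)
      (Measure.pi fun i => gammaMeasure (α i) 1) :=
    integrable_finsetSum _ fun j _ => hint j
  have habs (y : ℝ) : |y| ≤ c / 2 * y ^ 2 + 1 / (2 * c) := by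
    have h : c / 2 * y ^ 2 + 1 / (2 * c) - |y| = (c * |y| - 1) ^ 2 / (2 * c) := by
      rw [← sq_abs y]
      field_simp
      ring
    have : 0 ≤ (c * |y| - 1) ^ 2 / (2 * c) := by positivity
    linarith
  have hvar : ∫ g, ∑ j, (g j / ∑ i, g i - α j / A) ^ 2
      ∂Measure.pi (fun i => gammaMeasure (α i) 1) ≤ 1 / A := by
    rw [integral_finsetSum _ fun j _ => hint j]
    calc _ ≤ ∑ j, α j / A ^ 2 := by
          refine Finset.sum_le_sum fun j _ => ?_
          rw [integral_sq_div_sum_sub_mean hα j, ← hAdef, div_le_div_iff₀ (by positivity)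
            (by positivity)]
          have := mul_pos (mul_pos (hα j) (pow_pos hA 2))
            (add_pos_of_pos_of_nonneg one_pos (hα j).le)
          nlinarith
      _ = 1 / A := by
          rw [← Finset.sum_div, ← hAdef]
          field_simp
  calc _ ≤ ∫ g, (c / 2 * ∑ j, (g j / ∑ i, g i - α j / A) ^ 2 + k * (1 / (2 * c)))
        ∂Measure.pi (fun i => gammaMeasure (α i) 1) := by
        refine integral_mono_of_nonneg (ae_of_all _ fun g => by positivity)
          ((hint'.const_mul _).add (integrable_const _)) (ae_of_all _ fun g => ?_)
        refine (Finset.sum_le_sum fun j _ => habs (g j / ∑ i, g i - α j / A)).trans_eq ?_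
        simp [Finset.sum_add_distrib, Finset.mul_sum]
    _ ≤ c / 2 * (1 / A) + k * (1 / (2 * c)) := by
        rw [integral_add (hint'.const_mul _) (integrable_const _), integral_const_mul,
          integral_const, probReal_univ, one_smul]
        gcongr
    _ = A ^ (-(1 / 2) : ℝ) * Real.sqrt k := by
        rw [Real.rpow_neg hA.le, ← Real.sqrt_eq_rpow, hc]
        have h1 := Real.sq_sqrt hA.le
        have h2 := Real.sq_sqrt hk'.le
        have h3 : 0 < Real.sqrt A := by positivity
        have h4 : 0 < Real.sqrt k := by positivity
        generalize Real.sqrt A = a at *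
        generalize Real.sqrt (k : ℝ) = b at *
        rw [← h1, ← h2]
        field_simp
        ring

end
end
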